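/- arXiv:1812.11058 — 9 statements merged into one kernel-verified Lean document; each statement's English description precedes it below -/
import Mathlib

section
/- Let X be a real vector space and f : X → ℝ. Then for every x ∈ X the supremum, taken in ℝ ∪ {-∞} (with sup ∅ := -∞), of p(x) over all sublinear functions p : X → ℝ with p ≤ f pointwise on X, equals the infimum, taken in ℝ ∪ {-∞}, of the set { Σ_{k=1}^n t_k·f(x_k) : n ∈ ℕ, t_1,…,t_n ∈ ℝ, t_k ≥ 0, x_1,…,x_n ∈ X, Σ_{k=1}^n t_k·x_k = x }. In other words, the greatest sublinear minorant of f is given by this infimum formula. -/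
/-- The values `∑ tₖ * f xₖ` over all representations of `x` as a conic combination `∑ tₖ • xₖ`. -/
def conicValues {X : Type*} [AddCommGroup X] [Module ℝ X] (f : X → ℝ) (x : X) : Set ℝ :=
  {y | ∃ (n : ℕ) (t : Fin n → ℝ) (xs : Fin n → X),
    (∀ k, 0 ≤ t k) ∧ (∑ k, t k • xs k) = x ∧ y = ∑ k, t k * f (xs k)}

section ConicValues

variable {X : Type*} [AddCommGroup X] [Module ℝ X] {f : X → ℝ}

theorem apply_mem_conicValues (f : X → ℝ) (x : X) : f x ∈ conicValues f x :=
  ⟨1, fun _ => 1, fun _ => x, by simp, by simp, by simp⟩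

theorem add_mem_conicValues {x y : X} {a b : ℝ} (ha : a ∈ conicValues f x)
    (hb : b ∈ conicValues f y) : a + b ∈ conicValues f (x + y) := by
  obtain ⟨m, t, u, ht, rfl, rfl⟩ := ha
  obtain ⟨n, s, v, hs, rfl, rfl⟩ := hb
  refine ⟨m + n, Fin.append t s, Fin.append u v, fun k => ?_, ?_, ?_⟩
  · refine Fin.addCases (fun i => ?_) (fun i => ?_) k
    · simpa using ht i
    · simpa using hs i
  · simp [Fin.sum_univ_add]
  · simp [Fin.sum_univ_add]

theorem mul_mem_conicValues {x : X} {a c : ℝ} (hc : 0 ≤ c) (ha : a ∈ conicValues f x) :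
    c * a ∈ conicValues f (c • x) := by
  obtain ⟨n, t, u, ht, rfl, rfl⟩ := ha
  refine ⟨n, fun k => c * t k, u, fun k => mul_nonneg hc (ht k), ?_, ?_⟩
  · simp [Finset.smul_sum, mul_smul]
  · simp [Finset.mul_sum, mul_assoc]

theorem bddBelow_conicValues_of_bddBelow {x : X} (h : BddBelow (conicValues f x)) (y : X) :
    BddBelow (conicValues f y) := by
  obtain ⟨m, hm⟩ := h
  refine ⟨m - f (x - y), fun a ha => ?_⟩
  have hmem := add_mem_conicValues ha (apply_mem_conicValues f (x - y))
  rw [add_sub_cancel] at hmem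
  linarith [hm hmem]

theorem sInf_conicValues_add_le (h : ∀ x, BddBelow (conicValues f x)) (x y : X) :
    sInf (conicValues f (x + y)) ≤ sInf (conicValues f x) + sInf (conicValues f y) := by
  rw [← sub_le_iff_le_add]
  refine le_csInf ⟨_, apply_mem_conicValues f x⟩ fun a ha => ?_
  rw [sub_le_comm]
  refine le_csInf ⟨_, apply_mem_conicValues f y⟩ fun b hb => ?_
  rw [sub_le_iff_le_add']
  exact csInf_le (h _) (add_mem_conicValues ha hb)

theorem sInf_conicValues_smul_of_pos (h : ∀ x, BddBelow (conicValues f x)) {c : ℝ} (hc : 0 < c)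
    (x : X) : sInf (conicValues f (c • x)) = c * sInf (conicValues f x) := by
  have key : ∀ {d : ℝ}, 0 < d → ∀ y : X,
      sInf (conicValues f (d • y)) ≤ d * sInf (conicValues f y) := by
    intro d hd y
    rw [← div_le_iff₀' hd]
    refine le_csInf ⟨_, apply_mem_conicValues f y⟩ fun a ha => ?_
    rw [div_le_iff₀' hd]
    exact csInf_le (h _) (mul_mem_conicValues hd.le ha)
  refine le_antisymm (key hc x) ?_
  have hinv := key (inv_pos.2 hc) (c • x)
  rwa [inv_smul_smul₀ hc.ne', le_inv_mul_iff₀ hc] at hinv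

theorem sInf_conicValues_smul (h : ∀ x, BddBelow (conicValues f x)) {c : ℝ} (hc : 0 ≤ c)
    (x : X) : sInf (conicValues f (c • x)) = c * sInf (conicValues f x) := by
  obtain rfl | hc := hc.eq_or_lt
  · have hzero := sInf_conicValues_smul_of_pos h (two_pos : (0 : ℝ) < 2) (0 : X)
    rw [smul_zero] at hzero
    rw [zero_smul, zero_mul]
    linarith
  · exact sInf_conicValues_smul_of_pos h hc x

theorem le_of_mem_conicValues {p : X → ℝ} (hadd : ∀ a b, p (a + b) ≤ p a + p b)
    (hsmul : ∀ t : ℝ, 0 ≤ t → ∀ a, p (t • a) = t * p a) (hle : ∀ a, p a ≤ f a) {x : X} {y : ℝ}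
    (hy : y ∈ conicValues f x) : p x ≤ y := by
  obtain ⟨n, t, u, ht, rfl, rfl⟩ := hy
  have hzero : p 0 = 0 := by simpa using hsmul 0 le_rfl 0
  refine (Finset.le_sum_of_subadditive p hzero.le hadd _ _).trans ?_
  refine Finset.sum_le_sum fun k _ => ?_
  rw [hsmul _ (ht k)]
  exact mul_le_mul_of_nonneg_left (hle _) (ht k)

end ConicValues

/-
STATEMENT 0. Hahn–Banach theorem on envelopes, part III.1:
for a real vector space `X` and `f : X → ℝ`, the greatest sublinear
minorant of `f` (the supremum, in `ℝ ∪ {-∞}` realized inside `EReal`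
with `sSup ∅ = ⊥`, of `p x` over all sublinear `p ≤ f`) equals, at every
point `x`, the infimum of the quantities `∑ tₖ * f xₖ` over all finite
families with `tₖ ≥ 0` and `∑ tₖ • xₖ = x`.

A function `p : X → ℝ` is sublinear iff it is subadditive and positively
homogeneous (`p (t • a) = t * p a` for all `t ≥ 0`).
-/
theorem greatest_sublinear_minorant_eq_inf_representation
    {X : Type*} [AddCommGroup X] [Module ℝ X] (f : X → ℝ) (x : X) :
    sSup {y : EReal | ∃ p : X → ℝ,
        (∀ a b : X, p (a + b) ≤ p a + p b) ∧
        (∀ t : ℝ, 0 ≤ t → ∀ a : X, p (t • a) = t * p a) ∧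
        (∀ a : X, p a ≤ f a) ∧ y = (p x : EReal)} =
    sInf {y : EReal | ∃ (n : ℕ) (t : Fin n → ℝ) (xs : Fin n → X),
        (∀ k, 0 ≤ t k) ∧ (∑ k, t k • xs k) = x ∧
        y = ((∑ k, t k * f (xs k) : ℝ) : EReal)} := by
  have sInf_le_of {b : EReal} (hb : ∀ r : ℝ, b < r → ∃ y ∈ conicValues f x, y < r) :
      sInf {y : EReal | ∃ (n : ℕ) (t : Fin n → ℝ) (xs : Fin n → X),
        (∀ k, 0 ≤ t k) ∧ (∑ k, t k • xs k) = x ∧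
        y = ((∑ k, t k * f (xs k) : ℝ) : EReal)} ≤ b := by
    by_contra! hlt
    obtain ⟨r, hbr, hr⟩ := EReal.lt_iff_exists_real_btwn.1 hlt
    obtain ⟨_, ⟨n, t, u, ht, hx, rfl⟩, hyr⟩ := hb r hbr
    exact (hr.trans_le (sInf_le ⟨n, t, u, ht, hx, rfl⟩)).not_gt (EReal.coe_lt_coe_iff.2 hyr)
  apply le_antisymm
  · refine sSup_le ?_
    rintro _ ⟨p, hadd, hsmul, hle, rfl⟩
    refine le_sInf ?_
    rintro _ ⟨n, t, u, ht, hx, rfl⟩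
    exact EReal.coe_le_coe_iff.2
      (le_of_mem_conicValues hadd hsmul hle ⟨n, t, u, ht, hx, rfl⟩)
  · by_cases hbdd : BddBelow (conicValues f x)
    · have h := bddBelow_conicValues_of_bddBelow hbdd
      refine (sInf_le_of (b := (sInf (conicValues f x) : ℝ)) fun r hr => ?_).trans
        (le_sSup ⟨fun y => sInf (conicValues f y), sInf_conicValues_add_le h,
          fun t ht a => sInf_conicValues_smul h ht a,
          fun a => csInf_le (h a) (apply_mem_conicValues f a), rfl⟩)
      exact exists_lt_of_csInf_lt ⟨_, apply_mem_conicValues f x⟩ (EReal.coe_lt_coe_iff.1 hr)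
    · exact (sInf_le_of fun r _ => not_bddBelow_iff.1 hbdd r).trans bot_le
end

section
/- Let X = projlim X_n p_n be a regular projective limit of real vector lattices. Then: (i) if B ⊆ X is nonempty and for every n the projection pr_n B ⊆ X_n is a finite set, then the element v of the product ∏_n X_n defined by pr_n v = sup(pr_n B) (supremum in X_n) belongs to X and is the least upper bound of B both in ∏_n X_n and in X; (ii) consequently X is a vector lattice under the induced componentwise order, and for each n the image pr_n X is a vector lattice under the order induced from X_n; (iii) for each n the restriction of p_n to pr_{n+1} X maps into pr_n X and preserves binary suprema of elements of pr_{n+1} X. -/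
/-
A sequence `(X n)` of real vector lattices with positive linear maps
`p n : X (n+1) →ₗ[ℝ] X n` is given.  The projective limit
`projlim Xₙ pₙ` is realized as the submodule of the product `∀ n, X n`
consisting of all `x` with `x n = p n (x (n+1))` for all `n`, ordered
componentwise (the subtype order induced from the product order).
-/

variable {X : ℕ → Type*} [∀ n, Lattice (X n)] [∀ n, AddCommGroup (X n)]
  [∀ n, Module ℝ (X n)]
  [∀ n, CovariantClass (X n) (X n) (· + ·) (· ≤ ·)]
  [∀ n, PosSMulMono ℝ (X n)]

/-- The projective limit of the inverse system `p`, as a submodule of the product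
`∀ n, X n` (with the componentwise partial order). -/
def ProjLim (p : ∀ n, X (n + 1) →ₗ[ℝ] X n) : Submodule ℝ (∀ n, X n) where
  carrier := {x | ∀ n, x n = p n (x (n + 1))}
  add_mem' := by
    intro x y hx hy n
    show x n + y n = p n (x (n + 1) + y (n + 1))
    rw [map_add, ← hx n, ← hy n]
  zero_mem' := by
    intro n
    show (0 : X n) = p n 0
    rw [map_zero]
  smul_mem' := by
    intro c x hx n
    show c • x n = p n (c • x (n + 1))
    rw [map_smul, ← hx n]

/-- The image of the projective limit under the `n`-th coordinate projection. -/
def prIm (p : ∀ n, X (n + 1) →ₗ[ℝ] X n) (n : ℕ) : Set (X n) :=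
  (fun x : ∀ m, X m => x n) '' (ProjLim p : Set (∀ m, X m))

/-- A map preserving binary suprema preserves least upper bounds of nonempty finite sets. -/
theorem IsLUB.image_of_finite_of_map_sup {α β : Type*} [SemilatticeSup α] [SemilatticeSup β]
    {f : α → β} (hf : ∀ a b, f (a ⊔ b) = f a ⊔ f b) {s : Set α} (hfin : s.Finite)
    (hne : s.Nonempty) {a : α} (ha : IsLUB s a) : IsLUB (f '' s) (f a) := by
  lift s to Finset α using hfin
  have hs : s.Nonempty := by exact_mod_cast hne
  rw [ha.unique (Finset.isLUB_sup' hs), Finset.apply_sup'_eq_sup'_comp hs f hf]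
  constructor
  · rintro _ ⟨c, hc, rfl⟩
    exact Finset.le_sup' (f ∘ id) hc
  · intro b hb
    exact Finset.sup'_le hs _ fun c hc => hb ⟨c, hc, rfl⟩

theorem sup_mem_projLim {p : ∀ n, X (n + 1) →ₗ[ℝ] X n}
    (hreg : ∀ n, ∀ a b : X (n + 1), p n (a ⊔ b) = p n a ⊔ p n b) {x y : ∀ m, X m}
    (hx : x ∈ ProjLim p) (hy : y ∈ ProjLim p) : x ⊔ y ∈ ProjLim p := by
  intro n
  rw [Pi.sup_apply, Pi.sup_apply, hreg, ← hx n, ← hy n]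

theorem inf_mem_projLim {p : ∀ n, X (n + 1) →ₗ[ℝ] X n}
    (hreg : ∀ n, ∀ a b : X (n + 1), p n (a ⊔ b) = p n a ⊔ p n b) {x y : ∀ m, X m}
    (hx : x ∈ ProjLim p) (hy : y ∈ ProjLim p) : x ⊓ y ∈ ProjLim p := by
  have h : x ⊓ y = -(-x ⊔ -y) := by
    funext n
    have : AddLeftMono (X n) := ⟨fun a _ _ h => CovariantClass.elim a h⟩
    simp [neg_sup]
  rw [h]
  exact neg_mem (sup_mem_projLim hreg (neg_mem hx) (neg_mem hy))

/-
STATEMENT 1.  For a regular projective limit `X = projlim Xₙ pₙ` of real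
vector lattices (each `pₙ` positive linear preserving binary suprema):
(i) if `B ⊆ X` is nonempty with all coordinate projections finite, then
the vector `v` whose coordinates are the suprema of the projections lies
in `X` and is the least upper bound of `B` both in the product and in `X`;
(ii) `X` is a vector lattice under the induced order (pairs have suprema
and infima within `X`), and each projection `prₙ X` is a vector lattice
under the order induced from `Xₙ` (it is closed under `⊔` and `⊓`);
(iii) each `pₙ` maps `pr_{n+1} X` into `prₙ X` and preserves binary
suprema of elements of `pr_{n+1} X`.
-/
theorem regular_projLim_is_vector_lattice
    (p : ∀ n, X (n + 1) →ₗ[ℝ] X n)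
    (hpos : ∀ n, ∀ a : X (n + 1), 0 ≤ a → 0 ≤ p n a)
    (hreg : ∀ n, ∀ a b : X (n + 1), p n (a ⊔ b) = p n a ⊔ p n b) :
    -- (i)
    (∀ B : Set (∀ m, X m), B ⊆ (ProjLim p : Set (∀ m, X m)) → B.Nonempty →
      (∀ n, ((fun x : ∀ m, X m => x n) '' B).Finite) →
      ∃ v : ∀ m, X m, v ∈ ProjLim p ∧
        (∀ n, IsLUB ((fun x : ∀ m, X m => x n) '' B) (v n)) ∧
        IsLUB B v ∧
        (∀ w : ∀ m, X m, w ∈ ProjLim p → (∀ b ∈ B, b ≤ w) → v ≤ w)) ∧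
    -- (ii): X is a lattice under the induced order
    (∀ x : ∀ m, X m, x ∈ ProjLim p → ∀ y : ∀ m, X m, y ∈ ProjLim p →
      (∃ s : ∀ m, X m, s ∈ ProjLim p ∧ x ≤ s ∧ y ≤ s ∧
        ∀ w : ∀ m, X m, w ∈ ProjLim p → x ≤ w → y ≤ w → s ≤ w) ∧
      (∃ i : ∀ m, X m, i ∈ ProjLim p ∧ i ≤ x ∧ i ≤ y ∧
        ∀ w : ∀ m, X m, w ∈ ProjLim p → w ≤ x → w ≤ y → w ≤ i)) ∧
    -- (ii): each prₙ X is a vector lattice under the order induced from Xₙ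
    (∀ n, ∀ a ∈ prIm p n, ∀ b ∈ prIm p n, a ⊔ b ∈ prIm p n ∧ a ⊓ b ∈ prIm p n) ∧
    -- (iii)
    (∀ n, (∀ a ∈ prIm p (n + 1), p n a ∈ prIm p n) ∧
      (∀ a ∈ prIm p (n + 1), ∀ b ∈ prIm p (n + 1), p n (a ⊔ b) = p n a ⊔ p n b)) := by
  refine ⟨?_, ?_, ?_, ?_⟩
  · intro B hB hne hfin
    have hlub : ∀ n, ∃ a, IsLUB ((fun x : ∀ m, X m => x n) '' B) a := by
      intro n
      have hs : (hfin n).toFinset.Nonempty := by simpa using hne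
      exact ⟨_, by simpa using Finset.isLUB_sup' hs⟩
    choose v hv using hlub
    have hvB : IsLUB B v := isLUB_pi.mpr hv
    refine ⟨v, fun n => ?_, hv, hvB, fun w _ hw => hvB.2 hw⟩
    have himage : p n '' ((fun x : ∀ m, X m => x (n + 1)) '' B) =
        (fun x : ∀ m, X m => x n) '' B := by
      rw [Set.image_image]
      exact Set.image_congr fun x hx => (hB hx n).symm
    have h := (hv (n + 1)).image_of_finite_of_map_sup (hreg n) (hfin (n + 1)) (hne.image _)
    rw [himage] at h
    exact (hv n).unique h
  · intro x hx y hy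
    exact ⟨⟨x ⊔ y, sup_mem_projLim hreg hx hy, le_sup_left, le_sup_right,
        fun _ _ => sup_le⟩,
      ⟨x ⊓ y, inf_mem_projLim hreg hx hy, inf_le_left, inf_le_right, fun _ _ => le_inf⟩⟩
  · rintro n _ ⟨x, hx, rfl⟩ _ ⟨y, hy, rfl⟩
    exact ⟨⟨x ⊔ y, sup_mem_projLim hreg hx hy, rfl⟩, ⟨x ⊓ y, inf_mem_projLim hreg hx hy, rfl⟩⟩
  · refine fun n => ⟨?_, fun a _ b _ => hreg n a b⟩
    rintro _ ⟨x, hx, rfl⟩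
    exact ⟨x, hx, hx n⟩
end

section
/- Let X = projlim X_n p_n be a reduced regular projective limit of real vector lattices and let a : X → ℝ be additive (a(x+y) = a(x) + a(y) for all x, y ∈ X) and positive (a(x) ≥ 0 whenever x ≥ 0). Then there exists n₀ ∈ ℕ such that for every n ≥ n₀ there is an additive positive function a_n : X_n → ℝ with a(x) = a_n(pr_n x) for all x ∈ X. Conversely, for any additive positive a_n : X_n → ℝ, the function x ↦ a_n(pr_n x) is additive and positive on X. -/
/-
A sequence `(X n)` of real vector lattices with positive linear maps
`p n : X (n+1) →ₗ[ℝ] X n` is given.  The projective limit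
`projlim Xₙ pₙ` is realized as the submodule of the product `∀ n, X n`
consisting of all `x` with `x n = p n (x (n+1))` for all `n`, ordered
componentwise (the subtype order induced from the product order).
-/

variable {X : ℕ → Type*} [∀ n, Lattice (X n)] [∀ n, AddCommGroup (X n)]
  [∀ n, Module ℝ (X n)]
  [∀ n, CovariantClass (X n) (X n) (· + ·) (· ≤ ·)]
  [∀ n, PosSMulMono ℝ (X n)]

/-- An additive commutative group whose left translations are monotone is an ordered group. -/
theorem isOrderedAddMonoid_of_covariantClass {G : Type*} [AddCommGroup G] [PartialOrder G]
    [CovariantClass G G (· + ·) (· ≤ ·)] : IsOrderedAddMonoid G where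
  add_le_add_left _ _ h c := by simpa only [add_comm _ c] using CovariantClass.elim c h

namespace ProjLim

variable {p : ∀ n, X (n + 1) →ₗ[ℝ] X n}

omit [∀ n, Lattice (X n)] [∀ n, CovariantClass (X n) (X n) (· + ·) (· ≤ ·)]
  [∀ n, PosSMulMono ℝ (X n)] in
/-- If a coordinate of a point of the projective limit vanishes, so do all earlier ones. -/
theorem apply_eq_zero_of_le (x : ProjLim p) {m n : ℕ} (hmn : m ≤ n)
    (hx : (x : ∀ m, X m) n = 0) : (x : ∀ m, X m) m = 0 := by
  induction n, hmn using Nat.le_induction with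
  | base => exact hx
  | succ n _ ih => exact ih (by rw [x.2 n, hx, map_zero])

omit [∀ n, CovariantClass (X n) (X n) (· + ·) (· ≤ ·)] [∀ n, PosSMulMono ℝ (X n)] in
/-- The projective limit is closed under coordinatewise positive parts if the connecting maps
preserve suprema. -/
theorem sup_zero_mem (hreg : ∀ n, ∀ a b : X (n + 1), p n (a ⊔ b) = p n a ⊔ p n b)
    {x : ∀ n, X n} (hx : x ∈ ProjLim p) : x ⊔ 0 ∈ ProjLim p := by
  intro n
  simp only [Pi.sup_apply, Pi.zero_apply]
  rw [hreg, map_zero, ← hx n]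

omit [∀ n, PosSMulMono ℝ (X n)] in
/-- A sequence of positive elements whose `k`-th term vanishes at the `k`-th coordinate has an
upper bound for its partial sums. -/
theorem exists_sum_range_le (x : ℕ → ProjLim p) (hx : ∀ k, 0 ≤ x k)
    (hx0 : ∀ k, (x k : ∀ m, X m) k = 0) :
    ∃ s : ProjLim p, ∀ N, ∑ k ∈ Finset.range N, x k ≤ s := by
  have (n : ℕ) : IsOrderedAddMonoid (X n) := isOrderedAddMonoid_of_covariantClass
  refine ⟨⟨fun n => ∑ k ∈ Finset.range n, (x k : ∀ m, X m) n, fun n => ?_⟩, fun N n => ?_⟩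
  · beta_reduce
    rw [Finset.sum_range_succ, map_add, map_sum, ← (x n).2 n, hx0, add_zero]
    exact Finset.sum_congr rfl fun k _ => (x k).2 n
  · have hcoe : ((∑ k ∈ Finset.range N, x k : ProjLim p) : ∀ m, X m) n
        = ∑ k ∈ Finset.range N, (x k : ∀ m, X m) n := by
      rw [Submodule.coe_sum, Finset.sum_apply]
    change ((∑ k ∈ Finset.range N, x k : ProjLim p) : ∀ m, X m) n
      ≤ ∑ k ∈ Finset.range n, (x k : ∀ m, X m) n
    rw [hcoe]
    obtain hNn | hnN := le_total N n
    · exact Finset.sum_le_sum_of_subset_of_nonneg (Finset.range_subset_range.2 hNn)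
        fun k _ _ => hx k n
    · refine (Finset.sum_subset (Finset.range_subset_range.2 hnN) fun k _ hk => ?_).ge
      exact apply_eq_zero_of_le (x k) (by simpa using hk) (hx0 k)

omit [∀ n, PosSMulMono ℝ (X n)] in
/-- A positive additive functional vanishes on all positive elements with vanishing `n`-th
coordinate, for some `n`. -/
theorem exists_forall_nonneg_map_eq_zero (a : ProjLim p →+ ℝ) (ha : ∀ x, 0 ≤ x → 0 ≤ a x) :
    ∃ n, ∀ x : ProjLim p, 0 ≤ x → (x : ∀ m, X m) n = 0 → a x = 0 := by
  by_contra! h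
  have (n : ℕ) : IsOrderedAddMonoid (X n) := isOrderedAddMonoid_of_covariantClass
  choose x hx hx0 hax using h
  have hpos (k : ℕ) : 0 < a (x k) := (ha _ (hx k)).lt_of_ne' (hax k)
  choose c hc using fun k => Archimedean.arch (1 : ℝ) (hpos k)
  obtain ⟨s, hs⟩ := exists_sum_range_le (fun k => c k • x k)
    (fun k n => nsmul_nonneg (hx k n) (c k))
    (fun k => by
      change c k • (x k : ∀ m, X m) k = 0
      rw [hx0, nsmul_zero])
  obtain ⟨N, hN⟩ := exists_nat_gt (a s)
  have hle : (N : ℝ) ≤ a (∑ k ∈ Finset.range N, c k • x k) := by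
    rw [map_sum]
    simpa using Finset.card_nsmul_le_sum (Finset.range N) (fun k => a (c k • x k)) 1
      fun k _ => by simpa only [map_nsmul] using hc k
  have hsub := ha (s - ∑ k ∈ Finset.range N, c k • x k) fun n => sub_nonneg.2 (hs N n)
  rw [map_sub] at hsub
  linarith

omit [∀ n, PosSMulMono ℝ (X n)] in
/-- On a regular projective limit, a positive additive functional vanishes on the kernel of some
coordinate projection. -/
theorem exists_forall_map_eq_zero
    (hreg : ∀ n, ∀ a b : X (n + 1), p n (a ⊔ b) = p n a ⊔ p n b)
    (a : ProjLim p →+ ℝ) (ha : ∀ x, 0 ≤ x → 0 ≤ a x) :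
    ∃ n, ∀ x : ProjLim p, (x : ∀ m, X m) n = 0 → a x = 0 := by
  have (n : ℕ) : IsOrderedAddMonoid (X n) := isOrderedAddMonoid_of_covariantClass
  obtain ⟨n, hn⟩ := exists_forall_nonneg_map_eq_zero a ha
  refine ⟨n, fun x hx => ?_⟩
  let y : ProjLim p := ⟨(x : ∀ m, X m) ⊔ 0, sup_zero_mem hreg x.2⟩
  have hy : (y : ∀ m, X m) n = 0 := by
    change (x : ∀ m, X m) n ⊔ 0 = 0
    rw [hx, sup_idem]
  have h₁ := hn y (fun _ => le_sup_right) hy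
  have h₂ := hn (y - x) (fun _ => sub_nonneg.2 le_sup_left) (by
    change (y : ∀ m, X m) n - (x : ∀ m, X m) n = 0
    rw [hx, hy, sub_zero])
  rw [map_sub, h₁] at h₂
  linarith

end ProjLim

/-
STATEMENT 2.  On a reduced regular projective limit `X = projlim Xₙ pₙ`
of real vector lattices, every additive positive function `a : X → ℝ`
factors, for all sufficiently large `n`, as `a = aₙ ∘ prₙ` with
`aₙ : Xₙ → ℝ` additive and positive; conversely any such composition is
additive and positive on `X`.
-/
theorem additive_positive_factors_through_projection
    (p : ∀ n, X (n + 1) →ₗ[ℝ] X n)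
    (hpos : ∀ n, ∀ a : X (n + 1), 0 ≤ a → 0 ≤ p n a)
    (hreg : ∀ n, ∀ a b : X (n + 1), p n (a ⊔ b) = p n a ⊔ p n b)
    (hred : ∀ n, ∀ y : X n, ∃ x : ∀ m, X m, x ∈ ProjLim p ∧ x n = y) :
    (∀ a : ↥(ProjLim p) → ℝ,
      (∀ x y : ↥(ProjLim p), a (x + y) = a x + a y) →
      (∀ x : ↥(ProjLim p), 0 ≤ x → 0 ≤ a x) →
      ∃ n₀ : ℕ, ∀ n, n₀ ≤ n → ∃ aₙ : X n → ℝ,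
        (∀ u v : X n, aₙ (u + v) = aₙ u + aₙ v) ∧
        (∀ u : X n, 0 ≤ u → 0 ≤ aₙ u) ∧
        (∀ x : ↥(ProjLim p), a x = aₙ ((x : ∀ m, X m) n))) ∧
    (∀ n : ℕ, ∀ aₙ : X n → ℝ,
      (∀ u v : X n, aₙ (u + v) = aₙ u + aₙ v) →
      (∀ u : X n, 0 ≤ u → 0 ≤ aₙ u) →
      (∀ x y : ↥(ProjLim p),
          aₙ (((x + y : ↥(ProjLim p)) : ∀ m, X m) n)
            = aₙ ((x : ∀ m, X m) n) + aₙ ((y : ∀ m, X m) n)) ∧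
      (∀ x : ↥(ProjLim p), 0 ≤ x → 0 ≤ aₙ ((x : ∀ m, X m) n))) := by
  refine ⟨fun a hadd ha => ?_, fun n aₙ hadd ha =>
    ⟨fun x y => hadd _ _, fun x hx => ha _ (hx n)⟩⟩
  let f : ProjLim p →+ ℝ := AddMonoidHom.mk' a hadd
  obtain ⟨n₀, hn₀⟩ := ProjLim.exists_forall_map_eq_zero hreg f ha
  refine ⟨n₀, fun n hn => ?_⟩
  have hker (x y : ProjLim p) (h : (x : ∀ m, X m) n = (y : ∀ m, X m) n) : a x = a y := by
    have hxy : f (x - y) = 0 :=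
      hn₀ _ (ProjLim.apply_eq_zero_of_le _ hn (sub_eq_zero.2 h))
    rw [map_sub] at hxy
    exact sub_eq_zero.1 hxy
  choose g hg hgn using hred n
  refine ⟨fun u => a ⟨g u, hg u⟩, fun u v => ?_, fun u hu => ?_, fun x => ?_⟩
  · rw [← hadd]
    refine hker _ _ ?_
    change g (u + v) n = g u n + g v n
    simp only [hgn]
  · have h := hker ⟨g u, hg u⟩ ⟨g u ⊔ 0, ProjLim.sup_zero_mem hreg (hg u)⟩ (by
      change g u n = g u n ⊔ 0
      rw [hgn, sup_eq_left.2 hu])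
    exact (ha _ fun _ => le_sup_right).trans_eq h.symm
  · exact hker _ _ (hgn _).symm
end

section
/- Let X = projlim X_n p_n be a reduced regular projective limit of real vector lattices, and let (x^(k))_{k∈ℕ} be a sequence in X that stabilizes to x ∈ X, i.e. pr_n x^(k) = pr_n x whenever k ≥ n. Then the sequence is bounded above and below in X, for each n the supremum x̂^(n) := sup_{k ≥ n} x^(k) exists in X, the sequence (x̂^(n)) is decreasing, and its infimum exists in X and equals x; in particular the upper limit limsup_k x^(k) := inf_n sup_{k ≥ n} x^(k) exists and equals x. -/
/-
A sequence `(X n)` of real vector lattices with positive linear maps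
`p n : X (n+1) →ₗ[ℝ] X n` is given.  The projective limit
`projlim Xₙ pₙ` is realized as the submodule of the product `∀ n, X n`
consisting of all `x` with `x n = p n (x (n+1))` for all `n`, ordered
componentwise (the subtype order induced from the product order).
-/

variable {X : ℕ → Type*} [∀ n, Lattice (X n)] [∀ n, AddCommGroup (X n)]
  [∀ n, Module ℝ (X n)]
  [∀ n, CovariantClass (X n) (X n) (· + ·) (· ≤ ·)]
  [∀ n, PosSMulMono ℝ (X n)]

/-- In a regular projective limit, every tail of a stabilizing sequence has a coordinatewise
supremum in the limit. -/
theorem ProjLim.exists_forall_isLUB_tail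
    (p : ∀ n, X (n + 1) →ₗ[ℝ] X n)
    (hreg : ∀ n, ∀ a b : X (n + 1), p n (a ⊔ b) = p n a ⊔ p n b)
    (xs : ℕ → ↥(ProjLim p)) (x : ↥(ProjLim p))
    (hstab : ∀ n k : ℕ, n ≤ k → (xs k : ∀ m, X m) n = (x : ∀ m, X m) n) (n : ℕ) :
    ∃ s : ↥(ProjLim p), ∀ m,
      IsLUB ((fun k => (xs k : ∀ m, X m) m) '' Set.Ici n) ((s : ∀ m, X m) m) := by
  let f : ∀ m, ℕ → X m := fun m i => (xs (n + i) : ∀ m, X m) m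
  have hf : ∀ m i, m ≤ i → f m i = f m m := fun m i hi =>
    (hstab m (n + i) (by omega)).trans (hstab m (n + m) (by omega)).symm
  have hmap : ∀ m j, p m (partialSups (f (m + 1)) j) = partialSups (f m) j := by
    intro m j
    induction j with
    | zero => exact ((xs n).2 m).symm
    | succ j ih =>
      rw [partialSups_add_one, partialSups_add_one, hreg, ih]
      congr 1
      exact ((xs (n + (j + 1))).2 m).symm
  refine ⟨⟨fun m => partialSups (f m) m, fun m => ?_⟩, fun m => ⟨?_, fun u hu => ?_⟩⟩
  · rw [hmap, partialSups_add_one, hf m (m + 1) (Nat.le_succ m)]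
    exact (sup_eq_left.2 (le_partialSups (f m) m)).symm
  · rintro _ ⟨k, hk, rfl⟩
    obtain ⟨i, rfl⟩ := Nat.exists_eq_add_of_le (Set.mem_Ici.1 hk)
    change f m i ≤ partialSups (f m) m
    rcases le_total i m with hi | hi
    · exact le_partialSups_of_le (f m) hi
    · exact (hf m i hi).trans_le (le_partialSups (f m) m)
  · exact partialSups_le (f m) m u fun i _ => hu ⟨n + i, Nat.le_add_right n i, rfl⟩

/-
STATEMENT 7.  In a reduced regular projective limit of real vector
lattices, a sequence `xs` stabilizing to `x` (i.e. `prₙ (xs k) = prₙ x`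
for `k ≥ n`) is bounded above and below in `X`; for each `n` the
supremum `s n = sup_{k ≥ n} xs k` exists in `X`, the sequence `s` is
decreasing, and its infimum in `X` exists and equals `x` (so that
`limsup_k xs k = inf_n sup_{k ≥ n} xs k` exists and equals `x`).
-/
theorem stabilizing_sequence_has_limsup
    (p : ∀ n, X (n + 1) →ₗ[ℝ] X n)
    (hpos : ∀ n, ∀ a : X (n + 1), 0 ≤ a → 0 ≤ p n a)
    (hreg : ∀ n, ∀ a b : X (n + 1), p n (a ⊔ b) = p n a ⊔ p n b)
    (hred : ∀ n, ∀ y : X n, ∃ x : ∀ m, X m, x ∈ ProjLim p ∧ x n = y)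
    (xs : ℕ → ↥(ProjLim p)) (x : ↥(ProjLim p))
    (hstab : ∀ n k : ℕ, n ≤ k → (xs k : ∀ m, X m) n = (x : ∀ m, X m) n) :
    (∃ u : ↥(ProjLim p), ∀ k, xs k ≤ u) ∧
    (∃ b : ↥(ProjLim p), ∀ k, b ≤ xs k) ∧
    ∃ s : ℕ → ↥(ProjLim p),
      (∀ n : ℕ, IsLUB {y : ↥(ProjLim p) | ∃ k, n ≤ k ∧ y = xs k} (s n)) ∧
      (∀ n : ℕ, s (n + 1) ≤ s n) ∧
      IsGLB (Set.range s) x := by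
  choose s hs using ProjLim.exists_forall_isLUB_tail p hreg xs x hstab
  have hle : ∀ n k, n ≤ k → xs k ≤ s n := fun n k hk m => (hs n m).1 ⟨k, hk, rfl⟩
  obtain ⟨t, ht⟩ := ProjLim.exists_forall_isLUB_tail p hreg (fun k => -xs k) (-x)
    (fun n k hk => congrArg Neg.neg (hstab n k hk)) 0
  refine ⟨⟨s 0, fun k => hle 0 k k.zero_le⟩, ⟨-t, fun k m => ?_⟩, s, fun n => ⟨?_, ?_⟩,
    fun n m => ?_, ?_, fun b hb m => ?_⟩
  · exact neg_le.1 ((ht m).1 ⟨k, k.zero_le, rfl⟩)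
  · rintro _ ⟨k, hk, rfl⟩
    exact hle n k hk
  · intro u hu m
    refine (hs n m).2 ?_
    rintro _ ⟨k, hk, rfl⟩
    exact hu ⟨k, hk, rfl⟩ m
  · exact (hs (n + 1) m).mono (hs n m) (Set.image_mono (Set.Ici_subset_Ici.2 n.le_succ))
  · rintro _ ⟨n, rfl⟩ m
    exact (hstab m (max n m) (le_max_right n m)).symm.trans_le
      (hle n (max n m) (le_max_left n m) m)
  · refine (hb ⟨m, rfl⟩ m).trans ((hs m m).2 ?_)
    rintro _ ⟨k, hk, rfl⟩
    exact (hstab m k hk).le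
end

section
/- Let X = projlim X_n p_n be a reduced regular projective limit of real vector lattices, f : X → ℝ ∪ {±∞}, and for each n let f_n be the sup-projection of f onto X_n; assume that for some n the function f_n takes no value +∞. Let X_0 ⊆ X, let L be a set of real-valued functions on X_0 and, for each n, L_n a set of real-valued functions on pr_n X_0. Assume there is N ∈ ℕ such that for every n ≥ N: (a) every composition l_n ∘ pr_n with l_n ∈ L_n, restricted to X_0, belongs to L; and (b) for every x ∈ X_0, f_n(pr_n x) = inf{ l_n(pr_n x) : l_n ∈ L_n, f_n(y) ≤ l_n(y) for all y ∈ pr_n X_0 } (infimum in ℝ ∪ {±∞}, inf ∅ = +∞). Fix x ∈ X_0 and suppose either (i) for every sequence (x^(k)) in X stabilizing to x one has limsup_k f(x^(k)) ≤ f(x), or (ii) f is increasing and for every decreasing sequence (x^(k)) in X stabilizing to x one has inf_k f(x^(k)) ≤ f(inf_k x^(k)). Then f(x) = inf{ l(x) : l ∈ L, f(x') ≤ l(x') for all x' ∈ X_0 }. -/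
/-
A sequence `(X n)` of real vector lattices with positive linear maps
`p n : X (n+1) →ₗ[ℝ] X n` is given.  The projective limit
`projlim Xₙ pₙ` is realized as the submodule of the product `∀ n, X n`
consisting of all `x` with `x n = p n (x (n+1))` for all `n`, ordered
componentwise (the subtype order induced from the product order).
-/

variable {X : ℕ → Type*} [∀ n, Lattice (X n)] [∀ n, AddCommGroup (X n)]
  [∀ n, Module ℝ (X n)]
  [∀ n, CovariantClass (X n) (X n) (· + ·) (· ≤ ·)]
  [∀ n, PosSMulMono ℝ (X n)]

/-- The `sup`-projection of `f : X → ℝ ∪ {±∞}` onto `X n`: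
`fₙ y = sup { f x : x ∈ X, prₙ x = y }`, with values in `EReal`
(`sSup ∅ = ⊥ = -∞`). -/
noncomputable def supProj (p : ∀ n, X (n + 1) →ₗ[ℝ] X n)
    (f : ↥(ProjLim p) → EReal) (n : ℕ) (y : X n) : EReal :=
  sSup {r : EReal | ∃ x : ↥(ProjLim p), (x : ∀ m, X m) n = y ∧ r = f x}

/-- Every value of `f` is dominated by its `sup`-projections. -/
theorem le_supProj (p : ∀ n, X (n + 1) →ₗ[ℝ] X n) (f : ↥(ProjLim p) → EReal) (n : ℕ)
    (u : ↥(ProjLim p)) : f u ≤ supProj p f n ((u : ∀ m, X m) n) :=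
  le_sSup ⟨u, rfl, rfl⟩

/-- If all `sup`-projections of `f` from some index on exceed `r` along `x`, then some
sequence stabilizing to `x` has all its `f`-values above `r`. -/
theorem exists_stabilizing_of_lt_supProj (p : ∀ n, X (n + 1) →ₗ[ℝ] X n)
    (f : ↥(ProjLim p) → EReal) (x : ↥(ProjLim p)) (N : ℕ) (r : EReal)
    (h : ∀ n, N ≤ n → r < supProj p f n ((x : ∀ m, X m) n)) :
    ∃ xs : ℕ → ↥(ProjLim p),
      (∀ n k : ℕ, n ≤ k → (xs k : ∀ m, X m) n = (x : ∀ m, X m) n) ∧ ∀ k, r < f (xs k) := by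
  have hcoord : ∀ u v : ↥(ProjLim p), ∀ k, (u : ∀ m, X m) k = (v : ∀ m, X m) k →
      ∀ n, n ≤ k → (u : ∀ m, X m) n = (v : ∀ m, X m) n := by
    intro u v k huv n hn
    induction hn using Nat.decreasingInduction with
    | self => exact huv
    | of_succ n _ ih => rw [u.2 n, v.2 n, ih]
  have hex : ∀ k, ∃ u : ↥(ProjLim p),
      (u : ∀ m, X m) (max k N) = (x : ∀ m, X m) (max k N) ∧ r < f u := by
    intro k
    obtain ⟨_, ⟨u, hu, rfl⟩, hr⟩ := lt_sSup_iff.1 (h (max k N) (le_max_right k N))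
    exact ⟨u, hu, hr⟩
  choose xs hxs hr using hex
  exact ⟨xs, fun n k hnk => hcoord _ _ _ (hxs k) n (hnk.trans (le_max_left k N)), hr⟩

/-- In a regular projective limit, a sequence stabilizing to `x` is dominated by a decreasing
sequence stabilizing to `x` whose infimum is `x`. -/
theorem exists_antitone_stabilizing_ge (p : ∀ n, X (n + 1) →ₗ[ℝ] X n)
    (hreg : ∀ n, ∀ a b : X (n + 1), p n (a ⊔ b) = p n a ⊔ p n b)
    (x : ↥(ProjLim p)) (xs : ℕ → ↥(ProjLim p))
    (hxs : ∀ n k : ℕ, n ≤ k → (xs k : ∀ m, X m) n = (x : ∀ m, X m) n) :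
    ∃ ys : ℕ → ↥(ProjLim p), (∀ k, xs k ≤ ys k) ∧ (∀ k, ys (k + 1) ≤ ys k) ∧
      (∀ n k : ℕ, n ≤ k → (ys k : ∀ m, X m) n = (x : ∀ m, X m) n) ∧
      IsGLB (Set.range ys) x := by
  let S : ℕ → ∀ n, X n := fun k n => partialSups (fun i => (xs (k + i) : ∀ m, X m) n) n
  have hS : ∀ k n i, (xs (k + i) : ∀ m, X m) n ≤ S k n := by
    intro k n i
    rcases le_total i n with hi | hi
    · exact le_partialSups_of_le (fun i => (xs (k + i) : ∀ m, X m) n) hi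
    · rw [hxs n (k + i) (by omega), ← hxs n (k + n) (by omega)]
      exact le_partialSups (fun i => (xs (k + i) : ∀ m, X m) n) n
  have hmap : ∀ n, ∀ g : ℕ → X (n + 1), ∀ m,
      p n (partialSups g m) = partialSups (fun i => p n (g i)) m := by
    intro n g m
    induction m with
    | zero => simp
    | succ m ih => rw [partialSups_add_one, partialSups_add_one, hreg, ih]
  have hmem : ∀ k, S k ∈ ProjLim p := by
    intro k n
    have hp : ∀ i, p n ((xs (k + i) : ∀ m, X m) (n + 1)) = (xs (k + i) : ∀ m, X m) n :=
      fun i => ((xs (k + i)).2 n).symm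
    change S k n = p n (partialSups _ (n + 1))
    rw [hmap]
    simp only [hp]
    rw [partialSups_add_one]
    exact (sup_eq_left.2 (hS k n (n + 1))).symm
  have hstab : ∀ n k : ℕ, n ≤ k → S k n = (x : ∀ m, X m) n := by
    intro n k hnk
    refine le_antisymm (partialSups_le _ _ _ fun i _ => (hxs n (k + i) (by omega)).le) ?_
    rw [← hxs n (k + 0) hnk]
    exact hS k n 0
  refine ⟨fun k => ⟨S k, hmem k⟩, fun k n => hS k n 0, fun k n => ?_, hstab, ?_, ?_⟩
  · refine partialSups_le _ _ _ fun i _ => ?_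
    rw [add_assoc]
    exact hS k n (1 + i)
  · rintro _ ⟨k, rfl⟩ n
    rw [← hxs n (k + n) (by omega)]
    exact hS k n n
  · intro w hw n
    rw [← hstab n n le_rfl]
    exact hw ⟨n, rfl⟩ n

/-
STATEMENT 8.  (Theorem 3.1, scalar case.)  Let `fₙ` be the
sup-projections of `f : X → ℝ ∪ {±∞}`, with `fₘ` nowhere `+∞` for some
`m`.  If for all `n ≥ N` the compositions `lₙ ∘ prₙ` (restricted to
`X₀`) lie in `L` and `fₙ(prₙ x) = inf{ lₙ(prₙ x) : lₙ ∈ Lₙ, fₙ ≤ lₙ on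
prₙ X₀ }` for all `x ∈ X₀`, and if at a fixed `x ∈ X₀` either
(i) `limsup_k f(x⁽ᵏ⁾) ≤ f(x)` for every sequence stabilizing to `x`, or
(ii) `f` is increasing and `inf_k f(x⁽ᵏ⁾) ≤ f(inf_k x⁽ᵏ⁾)` for every
decreasing sequence stabilizing to `x`, then
`f x = inf{ l x : l ∈ L, f ≤ l on X₀ }`.
-/
theorem upper_envelope_on_projLim
    (p : ∀ n, X (n + 1) →ₗ[ℝ] X n)
    (hpos : ∀ n, ∀ a : X (n + 1), 0 ≤ a → 0 ≤ p n a)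
    (hreg : ∀ n, ∀ a b : X (n + 1), p n (a ⊔ b) = p n a ⊔ p n b)
    (hred : ∀ n, ∀ y : X n, ∃ x : ∀ m, X m, x ∈ ProjLim p ∧ x n = y)
    (f : ↥(ProjLim p) → EReal)
    (hftop : ∃ m : ℕ, ∀ y : X m, supProj p f m y ≠ ⊤)
    (X₀ : Set ↥(ProjLim p)) (L : Set (↥(ProjLim p) → ℝ))
    (Ln : ∀ n : ℕ, Set (X n → ℝ)) (N : ℕ)
    (hLn : ∀ n, N ≤ n → ∀ lₙ ∈ Ln n, ∃ l ∈ L,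
      ∀ x ∈ X₀, l x = lₙ ((x : ∀ m, X m) n))
    (henv : ∀ n, N ≤ n → ∀ x ∈ X₀,
      supProj p f n ((x : ∀ m, X m) n) =
        sInf {r : EReal | ∃ lₙ ∈ Ln n,
          (∀ y ∈ (fun x' : ↥(ProjLim p) => (x' : ∀ m, X m) n) '' X₀,
            supProj p f n y ≤ (lₙ y : EReal)) ∧
          r = (lₙ ((x : ∀ m, X m) n) : EReal)})
    (x : ↥(ProjLim p)) (hx : x ∈ X₀)
    (hcond :
      (∀ xs : ℕ → ↥(ProjLim p),
        (∀ n k : ℕ, n ≤ k → (xs k : ∀ m, X m) n = (x : ∀ m, X m) n) →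
        Filter.limsup (fun k => f (xs k)) Filter.atTop ≤ f x) ∨
      ((∀ u v : ↥(ProjLim p), u ≤ v → f u ≤ f v) ∧
       (∀ xs : ℕ → ↥(ProjLim p),
        (∀ k : ℕ, xs (k + 1) ≤ xs k) →
        (∀ n k : ℕ, n ≤ k → (xs k : ∀ m, X m) n = (x : ∀ m, X m) n) →
        ∀ w : ↥(ProjLim p), IsGLB (Set.range xs) w →
          (⨅ k, f (xs k)) ≤ f w))) :
    f x = sInf {r : EReal | ∃ l ∈ L,
      (∀ x' ∈ X₀, f x' ≤ (l x' : EReal)) ∧ r = (l x : EReal)} := by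
  refine le_antisymm (le_sInf ?_) ?_
  · rintro _ ⟨l, -, hl, rfl⟩
    exact hl x hx
  have hle : ∀ n, N ≤ n → sInf {r : EReal | ∃ l ∈ L,
      (∀ x' ∈ X₀, f x' ≤ (l x' : EReal)) ∧ r = (l x : EReal)} ≤
      supProj p f n ((x : ∀ m, X m) n) := by
    intro n hn
    rw [henv n hn x hx]
    refine le_sInf ?_
    rintro _ ⟨lₙ, hlₙ, hdom, rfl⟩
    obtain ⟨l, hl, hcomp⟩ := hLn n hn lₙ hlₙ
    refine sInf_le ⟨l, hl, fun x' hx' => ?_, by rw [hcomp x hx]⟩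
    rw [hcomp x' hx']
    exact (le_supProj p f n x').trans (hdom _ ⟨x', hx', rfl⟩)
  by_contra hlt
  obtain ⟨r, hfr, hr⟩ := exists_between (not_le.1 hlt)
  obtain ⟨xs, hstab, hrxs⟩ := exists_stabilizing_of_lt_supProj p f x N r
    fun n hn => hr.trans_le (hle n hn)
  refine hfr.not_ge ?_
  rcases hcond with h | ⟨hmono, h⟩
  · refine le_trans ?_ (h xs hstab)
    exact Filter.le_limsup_of_frequently_le (Filter.Frequently.of_forall fun k => (hrxs k).le)
  · obtain ⟨ys, hge, hanti, hys, hglb⟩ := exists_antitone_stabilizing_ge p hreg x xs hstab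
    exact (le_iInf fun k => (hrxs k).le.trans (hmono _ _ (hge k))).trans
      (h ys hanti hys x hglb)
end

section
/- Let X be an ordered real vector space, H ⊆ X a convex set, and q : H → ℝ a concave function (q(t·h + (1-t)·h') ≥ t·q(h) + (1-t)·q(h') for all h, h' ∈ H and t ∈ (0,1)). Define spf_{H,q}(x) = sup{ q(h) : h ∈ H, h ≤ x } with values in ℝ ∪ {±∞} (sup ∅ = -∞). If spf_{H,q} takes no value +∞ on X, then spf_{H,q} is concave: spf(t·x + (1-t)·y) ≥ t·spf(x) + (1-t)·spf(y) in ℝ ∪ {-∞} for all x, y ∈ X and t ∈ (0,1). -/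
/-- The supremal function generated by `q` relative to `H`:
`spf H q x = sup { q h : h ∈ H, h ≤ x }`, with values in `EReal`
(`sSup ∅ = ⊥ = -∞`). -/
noncomputable def spf {Z : Type*} [Preorder Z] (H : Set Z) (q : Z → ℝ)
    (x : Z) : EReal :=
  sSup {r : EReal | ∃ h ∈ H, h ≤ x ∧ r = (q h : EReal)}

theorem coe_le_spf {Z : Type*} [Preorder Z] {H : Set Z} (q : Z → ℝ) {x h : Z}
    (hh : h ∈ H) (hx : h ≤ x) : (q h : EReal) ≤ spf H q x :=
  le_sSup ⟨h, hh, hx, rfl⟩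

theorem spf_le {Z : Type*} [Preorder Z] {H : Set Z} {q : Z → ℝ} {x : Z} {c : EReal}
    (hc : ∀ h ∈ H, h ≤ x → (q h : EReal) ≤ c) : spf H q x ≤ c :=
  sSup_le fun _ ⟨h, hh, hx, hr⟩ => hr ▸ hc h hh hx

theorem exists_mem_le_of_spf_ne_bot {Z : Type*} [Preorder Z] {H : Set Z} {q : Z → ℝ} {x : Z}
    (hx : spf H q x ≠ ⊥) : ∃ h ∈ H, h ≤ x := by
  by_contra! hne
  exact hx (le_bot_iff.mp (spf_le fun h hh hhx => absurd hhx (hne h hh)))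

/-
STATEMENT 12.  On an ordered real vector space `X`, if `H` is a convex
set and `q` is concave on `H`, and the supremal function `spf H q`
takes no value `+∞`, then `spf H q` is concave (with values in
`ℝ ∪ {-∞}`, computing in `EReal`).
-/
theorem spf_concave
    {X : Type*} [AddCommGroup X] [Module ℝ X] [PartialOrder X]
    [CovariantClass X X (· + ·) (· ≤ ·)] [PosSMulMono ℝ X]
    (H : Set X) (q : X → ℝ)
    (hHconv : ∀ t : ℝ, 0 < t → t < 1 → ∀ h ∈ H, ∀ h' ∈ H,
      t • h + (1 - t) • h' ∈ H)
    (hqconc : ∀ t : ℝ, 0 < t → t < 1 → ∀ h ∈ H, ∀ h' ∈ H,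
      t * q h + (1 - t) * q h' ≤ q (t • h + (1 - t) • h'))
    (htop : ∀ x : X, spf H q x ≠ ⊤) :
    ∀ t : ℝ, 0 < t → t < 1 → ∀ x y : X,
      (t : EReal) * spf H q x + ((1 - t : ℝ) : EReal) * spf H q y ≤
        spf H q (t • x + (1 - t) • y) := by
  intro t ht ht1 x y
  have hs : 0 < 1 - t := sub_pos.mpr ht1
  by_cases hx : spf H q x = ⊥
  · rw [hx, EReal.coe_mul_bot_of_pos ht, EReal.bot_add]
    exact bot_le
  by_cases hy : spf H q y = ⊥
  · rw [hy, EReal.coe_mul_bot_of_pos hs, EReal.add_bot]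
    exact bot_le
  have hcomb : ∀ h ∈ H, h ≤ x → ∀ h' ∈ H, h' ≤ y →
      ((t * q h + (1 - t) * q h' : ℝ) : EReal) ≤ spf H q (t • x + (1 - t) • y) := by
    intro h hh hhx h' hh' hhy
    refine (EReal.coe_le_coe_iff.mpr (hqconc t ht ht1 h hh h' hh')).trans
      (coe_le_spf q (hHconv t ht ht1 h hh h' hh') ?_)
    exact add_le_add (smul_le_smul_of_nonneg_left hhx ht.le)
      (smul_le_smul_of_nonneg_left hhy hs.le)
  obtain ⟨h₀, hh₀, hx₀⟩ := exists_mem_le_of_spf_ne_bot hx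
  obtain ⟨k₀, hk₀, hy₀⟩ := exists_mem_le_of_spf_ne_bot hy
  have hz : spf H q (t • x + (1 - t) • y) ≠ ⊥ :=
    ne_bot_of_le_ne_bot (EReal.coe_ne_bot _) (hcomb h₀ hh₀ hx₀ k₀ hk₀ hy₀)
  obtain ⟨a, ha⟩ : ∃ a : ℝ, (a : EReal) = spf H q x := ⟨_, EReal.coe_toReal (htop x) hx⟩
  obtain ⟨b, hb⟩ : ∃ b : ℝ, (b : EReal) = spf H q y := ⟨_, EReal.coe_toReal (htop y) hy⟩
  obtain ⟨c, hc⟩ : ∃ c : ℝ, (c : EReal) = spf H q (t • x + (1 - t) • y) :=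
    ⟨_, EReal.coe_toReal (htop _) hz⟩
  rw [← hc] at hcomb
  have hleft : ∀ k ∈ H, k ≤ y → t * a + (1 - t) * q k ≤ c := by
    intro k hk hky
    have hle : (a : EReal) ≤ (((c - (1 - t) * q k) / t : ℝ) : EReal) := by
      rw [ha]
      refine spf_le fun h hh hhx => EReal.coe_le_coe_iff.mpr ?_
      rw [le_div_iff₀ ht]
      linarith [EReal.coe_le_coe_iff.mp (hcomb h hh hhx k hk hky)]
    rw [EReal.coe_le_coe_iff, le_div_iff₀ ht] at hle
    linarith
  have hle : (b : EReal) ≤ (((c - t * a) / (1 - t) : ℝ) : EReal) := by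
    rw [hb]
    refine spf_le fun k hk hky => EReal.coe_le_coe_iff.mpr ?_
    rw [le_div_iff₀ hs]
    linarith [hleft k hk hky]
  rw [EReal.coe_le_coe_iff, le_div_iff₀ hs] at hle
  rw [← ha, ← hb, ← hc, ← EReal.coe_mul, ← EReal.coe_mul, ← EReal.coe_add,
    EReal.coe_le_coe_iff]
  linarith
end

section
/- Let X = projlim X_n p_n be a reduced regular projective limit of real vector lattices, X_0 ⊆ X a linear subspace, q₁ : X_1 → ℝ increasing and superlinear, q := q₁ ∘ pr_1 : X → ℝ, H ⊆ X a convex cone, and H_n := pr_n H. Assume: (i) for every n there is h ∈ H_n with h ≤ 0 in X_n; (ii) for every n and every y ∈ pr_n X_0 there is h ∈ H_n with h ≤ y; (iii) every nonempty subset of H that is bounded above in X has a supremum in X which belongs to H; (iv) every decreasing sequence in H that is bounded below in X has an infimum in X which belongs to H; (v) whenever (h^(k)) ⊆ H is a decreasing sequence with inf_k q(h^(k)) > -∞, the sequence is bounded below in X and q(inf_k h^(k)) ≥ inf_k q(h^(k)). Then the supremal function spf_{H,q}(x) = sup{ q(h) : h ∈ H, h ≤ x } (values in ℝ ∪ {±∞},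 sup ∅ = -∞) is superadditive and positively homogeneous (for t > 0), and for every x ∈ X_0: spf_{H,q}(x) = inf{ l(x) : l : X_0 → ℝ linear, and q(h) ≤ l(x') for all h ∈ H and x' ∈ X_0 with h ≤ x' }, the infimum taken in ℝ ∪ {±∞} with inf ∅ = +∞. -/
/-
A sequence `(X n)` of real vector lattices with positive linear maps
`p n : X (n+1) →ₗ[ℝ] X n` is given.  The projective limit
`projlim Xₙ pₙ` is realized as the submodule of the product `∀ n, X n`
consisting of all `x` with `x n = p n (x (n+1))` for all `n`, ordered
componentwise (the subtype order induced from the product order).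
-/

variable {X : ℕ → Type*} [∀ n, Lattice (X n)] [∀ n, AddCommGroup (X n)]
  [∀ n, Module ℝ (X n)]
  [∀ n, CovariantClass (X n) (X n) (· + ·) (· ≤ ·)]
  [∀ n, PosSMulMono ℝ (X n)]

section Spf

variable {Z : Type*} [AddCommGroup Z] [Module ℝ Z] [Preorder Z] {H : Set Z} {q : Z → ℝ}

omit [AddCommGroup Z] [Module ℝ Z] in
theorem le_spf {h x : Z} (hh : h ∈ H) (hx : h ≤ x) : (q h : EReal) ≤ spf H q x :=
  le_sSup ⟨h, hh, hx, rfl⟩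

omit [Module ℝ Z] in
theorem spf_add_le (hle : ∀ a b c d : Z, a ≤ b → c ≤ d → a + c ≤ b + d)
    (hH : ∀ h ∈ H, ∀ h' ∈ H, h + h' ∈ H) (hq : ∀ a b, q a + q b ≤ q (a + b)) (x y : Z) :
    spf H q x + spf H q y ≤ spf H q (x + y) := by
  refine EReal.add_le_of_forall_lt fun a ha b hb => ?_
  obtain ⟨_, ⟨h, hh, hx, rfl⟩, ha⟩ := lt_sSup_iff.1 ha
  obtain ⟨_, ⟨h', hh', hy, rfl⟩, hb⟩ := lt_sSup_iff.1 hb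
  calc a + b ≤ (q h : EReal) + q h' := add_le_add ha.le hb.le
    _ ≤ (q (h + h') : ℝ) := by exact_mod_cast hq h h'
    _ ≤ spf H q (x + y) := le_spf (hH h hh h' hh') (hle _ _ _ _ hx hy)

theorem spf_smul (hle : ∀ t : ℝ, 0 < t → ∀ a b : Z, a ≤ b → t • a ≤ t • b)
    (hH : ∀ t : ℝ, 0 < t → ∀ h ∈ H, t • h ∈ H)
    (hq : ∀ t : ℝ, 0 < t → ∀ a, q (t • a) = t * q a) {t : ℝ} (ht : 0 < t) (x : Z) :
    spf H q (t • x) = (t : EReal) * spf H q x := by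
  apply le_antisymm
  · refine sSup_le ?_
    rintro _ ⟨h, hh, hx, rfl⟩
    have hx' : t⁻¹ • h ≤ x := by
      simpa [smul_smul, inv_mul_cancel₀ ht.ne'] using hle _ (inv_pos.2 ht) _ _ hx
    have hqh : q h = t * q (t⁻¹ • h) := by
      rw [hq _ (inv_pos.2 ht), mul_inv_cancel_left₀ ht.ne']
    rw [hqh, EReal.coe_mul]
    exact mul_le_mul_of_nonneg_left (le_spf (hH _ (inv_pos.2 ht) h hh) hx')
      (EReal.coe_nonneg.2 ht.le)
  · rw [mul_comm, ← EReal.le_div_iff_mul_le (EReal.coe_pos.2 ht) (EReal.coe_ne_top t)]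
    refine sSup_le ?_
    rintro _ ⟨h, hh, hx, rfl⟩
    rw [EReal.le_div_iff_mul_le (EReal.coe_pos.2 ht) (EReal.coe_ne_top t), mul_comm,
      ← EReal.coe_mul, ← hq t ht]
    exact le_spf (hH t ht h hh) (hle t ht _ _ hx)

end Spf

/-- Hahn–Banach: a sublinear function is attained at every point by a dominated linear
functional. -/
theorem exists_linearMap_le_sublinear_eq {E : Type*} [AddCommGroup E] [Module ℝ E] (N : E → ℝ)
    (hsmul : ∀ t : ℝ, 0 < t → ∀ x, N (t • x) = t * N x)
    (hadd : ∀ x y, N (x + y) ≤ N x + N y) (x : E) :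
    ∃ l : E →ₗ[ℝ] ℝ, (∀ y, l y ≤ N y) ∧ l x = N x := by
  have h0 : N 0 = 0 := by
    have := hsmul 2 two_pos 0
    rw [smul_zero] at this
    linarith
  have hneg : -N x ≤ N (-x) := by
    have := hadd x (-x)
    rw [add_neg_cancel, h0] at this
    linarith
  have hx : ∀ c : ℝ, c • x = 0 → c • N x = 0 := by
    intro c hc
    rcases smul_eq_zero.1 hc with rfl | rfl
    · exact zero_smul ℝ _
    · rw [h0, smul_zero]
  obtain ⟨l, hl, hlN⟩ := exists_extension_of_le_sublinear
    (LinearPMap.mkSpanSingleton' x (N x) hx) N hsmul hadd (by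
      rintro ⟨y, hy⟩
      obtain ⟨c, rfl⟩ := Submodule.mem_span_singleton.1 hy
      rw [LinearPMap.mkSpanSingleton'_apply, smul_eq_mul]
      rcases lt_trichotomy c 0 with hc | rfl | hc
      · have h := hsmul (-c) (neg_pos.2 hc) (-x)
        rw [neg_smul_neg] at h
        change c * N x ≤ N (c • x)
        rw [h]
        nlinarith
      · simp [h0]
      · exact (hsmul c hc x).ge)
  refine ⟨l, hlN, ?_⟩
  have h := hl ⟨x, Submodule.mem_span_singleton_self x⟩
  exact h.trans (LinearPMap.mkSpanSingleton'_apply_self x (N x) hx _)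

/-- A superadditive and positively homogeneous family of nonempty sets of reals, bounded above,
is dominated by a linear functional that attains the supremum at a prescribed point. -/
theorem exists_linearMap_ge_eq_sSup {E : Type*} [AddCommGroup E] [Module ℝ E] (A : E → Set ℝ)
    (hne : ∀ x, (A x).Nonempty) (hbdd : ∀ x, BddAbove (A x))
    (hadd : ∀ x y, ∀ a ∈ A x, ∀ b ∈ A y, ∃ c ∈ A (x + y), a + b ≤ c)
    (hsmul : ∀ t : ℝ, 0 < t → ∀ x, ∀ a ∈ A x, t * a ∈ A (t • x)) (x : E) :
    ∃ l : E →ₗ[ℝ] ℝ, (∀ y, ∀ a ∈ A y, a ≤ l y) ∧ l x = sSup (A x) := by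
  have hsup_smul : ∀ t : ℝ, 0 < t → ∀ y, t * sSup (A y) ≤ sSup (A (t • y)) := by
    intro t ht y
    rw [← le_div_iff₀' ht]
    refine csSup_le (hne y) fun a ha => ?_
    rw [le_div_iff₀' ht]
    exact le_csSup (hbdd _) (hsmul t ht y a ha)
  obtain ⟨l, hl, hlx⟩ := exists_linearMap_le_sublinear_eq (fun y => -sSup (A y))
    (fun t ht y => by
      have h₁ := hsup_smul t ht y
      have h₂ := hsup_smul t⁻¹ (inv_pos.2 ht) (t • y)
      rw [inv_smul_smul₀ ht.ne', inv_mul_le_iff₀ ht] at h₂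
      linarith)
    (fun y z => by
      have h : sSup (A y) ≤ sSup (A (y + z)) - sSup (A z) := by
        refine csSup_le (hne y) fun a ha => ?_
        have h' : sSup (A z) ≤ sSup (A (y + z)) - a := by
          refine csSup_le (hne z) fun b hb => ?_
          obtain ⟨c, hc, hab⟩ := hadd y z a ha b hb
          linarith [le_csSup (hbdd _) hc]
        linarith
      linarith) x
  refine ⟨-l, fun y a ha => ?_, by simp [hlx]⟩
  have h₁ := hl y
  have h₂ := le_csSup (hbdd y) ha
  simp only [LinearMap.neg_apply]
  linarith

namespace ProjLim

variable {p : ∀ n, X (n + 1) →ₗ[ℝ] X n}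

omit [∀ n, CovariantClass (X n) (X n) (· + ·) (· ≤ ·)] [∀ n, PosSMulMono ℝ (X n)] in
theorem apply_le_of_le (hreg : ∀ n, ∀ a b : X (n + 1), p n (a ⊔ b) = p n a ⊔ p n b)
    {x y : ProjLim p} {m n : ℕ} (hmn : m ≤ n)
    (h : (x : ∀ m, X m) n ≤ (y : ∀ m, X m) n) : (x : ∀ m, X m) m ≤ (y : ∀ m, X m) m := by
  induction n, hmn using Nat.le_induction with
  | base => exact h
  | succ n _ ih =>
    refine ih ?_
    rw [x.2 n, y.2 n, ← sup_eq_right, ← hreg, sup_eq_right.2 h]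

omit [∀ n, CovariantClass (X n) (X n) (· + ·) (· ≤ ·)] [∀ n, PosSMulMono ℝ (X n)] in
/-- A sequence whose `n`-th term is below `x` at level `n` has an upper bound which stays below
`x` at every level where all the terms do. -/
theorem exists_upperBound (hreg : ∀ n, ∀ a b : X (n + 1), p n (a ⊔ b) = p n a ⊔ p n b)
    (x : ProjLim p) (g : ℕ → ProjLim p)
    (hg : ∀ n, (g n : ∀ m, X m) n ≤ (x : ∀ m, X m) n) :
    ∃ u : ProjLim p, (∀ n, g n ≤ u) ∧
      ∀ k, (∀ n < k, (g n : ∀ m, X m) k ≤ (x : ∀ m, X m) k) →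
        (u : ∀ m, X m) k ≤ (x : ∀ m, X m) k := by
  have hlt : ∀ m n, m ≤ n → (g n : ∀ m, X m) m ≤ (x : ∀ m, X m) m :=
    fun m n hmn => apply_le_of_le hreg hmn (hg n)
  let W : ∀ m, ℕ → X m := fun m n => (x : ∀ m, X m) m ⊔ (g n : ∀ m, X m) m
  have hW : ∀ m n, p m (W (m + 1) n) = W m n := fun m n => by
    simp only [W]
    rw [hreg, ← x.2 m, ← (g n).2 m]
  have hxW : ∀ m n, (x : ∀ m, X m) m ≤ partialSups (W m) n := fun m n =>
    le_sup_left.trans (le_partialSups (W m) n)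
  have hpW : ∀ m n, p m (partialSups (W (m + 1)) n) = partialSups (W m) n := by
    intro m n
    induction n with
    | zero => simp [hW]
    | succ n ih => rw [partialSups_add_one, partialSups_add_one, hreg, ih, hW]
  refine ⟨⟨fun m => partialSups (W m) m, fun m => ?_⟩, fun n m => ?_, fun k hk => ?_⟩
  · rw [hpW, partialSups_add_one, sup_eq_left.2]
    exact sup_le (hxW m m) ((hlt m (m + 1) m.le_succ).trans (hxW m m))
  · rcases le_total n m with h | h
    · exact le_sup_right.trans (le_partialSups_of_le (W m) h)
    · exact (hlt m n h).trans (hxW m m)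
  · refine partialSups_le _ _ _ fun n hn => sup_le le_rfl ?_
    rcases hn.lt_or_eq with h | rfl
    · exact hk n h
    · exact hg n

omit [∀ n, CovariantClass (X n) (X n) (· + ·) (· ≤ ·)] [∀ n, PosSMulMono ℝ (X n)] in
/-- Members of `H` lying below `x` at ever higher levels, with values of `q` bounded below by `c`,
yield a member of `H` lying below `x` whose value is at least `c`. -/
theorem exists_mem_le_of_forall_level
    (hreg : ∀ n, ∀ a b : X (n + 1), p n (a ⊔ b) = p n a ⊔ p n b)
    {q1 : X 0 → ℝ} (hq1mono : Monotone q1) {H : Set (ProjLim p)}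
    (hsup : ∀ S : Set (ProjLim p), S ⊆ H → S.Nonempty →
      (∃ u : ProjLim p, ∀ s ∈ S, s ≤ u) → ∃ v ∈ H, IsLUB S v)
    (hinf : ∀ h : ℕ → ProjLim p, (∀ k, h k ∈ H) →
      (∀ k, h (k + 1) ≤ h k) → (∃ b : ProjLim p, ∀ k, b ≤ h k) →
      ∃ v ∈ H, IsGLB (Set.range h) v)
    (hqv : ∀ h : ℕ → ProjLim p, (∀ k, h k ∈ H) →
      (∀ k, h (k + 1) ≤ h k) →
      BddBelow (Set.range fun k => q1 ((h k : ∀ m, X m) 0)) →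
      (∃ b : ProjLim p, ∀ k, b ≤ h k) ∧
      (∀ w : ProjLim p, IsGLB (Set.range h) w →
        (⨅ k, q1 ((h k : ∀ m, X m) 0)) ≤ q1 ((w : ∀ m, X m) 0)))
    (x : ProjLim p) (c : ℝ)
    (hc : ∀ n, ∃ h ∈ H, (h : ∀ m, X m) n ≤ (x : ∀ m, X m) n ∧ c ≤ q1 ((h : ∀ m, X m) 0)) :
    ∃ h ∈ H, h ≤ x ∧ c ≤ q1 ((h : ∀ m, X m) 0) := by
  choose h hH hx hcq using hc
  have tail : ∀ k, ∃ v ∈ H, IsLUB (h '' Set.Ici k) v ∧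
      (v : ∀ m, X m) k ≤ (x : ∀ m, X m) k := by
    intro k
    obtain ⟨u, hu, hux⟩ := exists_upperBound hreg x (fun n => if k ≤ n then h n else x)
      (fun n => by
        by_cases hn : k ≤ n
        · simpa [hn] using hx n
        · simp [hn])
    have hub : ∀ s ∈ h '' Set.Ici k, s ≤ u := by
      rintro _ ⟨n, hn, rfl⟩
      simpa [Set.mem_Ici.1 hn] using hu n
    obtain ⟨v, hv, hlub⟩ := hsup (h '' Set.Ici k) (by rintro _ ⟨n, -, rfl⟩; exact hH n)
      (Set.nonempty_Ici.image h) ⟨u, hub⟩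
    exact ⟨v, hv, hlub, (hlub.2 hub k).trans (hux k fun n hn => by simp [hn.not_ge])⟩
  choose g hgH hglub hgx using tail
  have hanti : ∀ k, g (k + 1) ≤ g k := fun k =>
    (hglub (k + 1)).mono (hglub k) (Set.image_mono (Set.Ici_subset_Ici.2 k.le_succ))
  have hcg : ∀ k, c ≤ q1 ((g k : ∀ m, X m) 0) := fun k =>
    (hcq k).trans (hq1mono ((hglub k).1 ⟨k, Set.self_mem_Ici, rfl⟩ 0))
  obtain ⟨hb, hq⟩ := hqv g hgH hanti ⟨c, by rintro _ ⟨k, rfl⟩; exact hcg k⟩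
  obtain ⟨w, hwH, hw⟩ := hinf g hgH hanti hb
  exact ⟨w, hwH, fun m => (hw.1 ⟨m, rfl⟩ m).trans (hgx m), (le_ciInf hcg).trans (hq w hw)⟩

end ProjLim

/-
STATEMENT 15.  (Theorem on the representation of the supremal function;
scalar case.)  Under hypotheses (i)–(v) on the convex cone `H` in the
reduced regular projective limit `X` and the increasing superlinear
`q₁ : X₁ → ℝ` (here `X 0`), `q = q₁ ∘ pr₁`, the supremal function
`spf H q` is superadditive and positively homogeneous, and on the linear
subspace `X₀` it equals the lower envelope of its sweepings-out by
linear functionals `l : X₀ → ℝ`.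
-/
theorem spf_representation_by_linear_sweepings
    (p : ∀ n, X (n + 1) →ₗ[ℝ] X n)
    (hpos : ∀ n, ∀ a : X (n + 1), 0 ≤ a → 0 ≤ p n a)
    (hreg : ∀ n, ∀ a b : X (n + 1), p n (a ⊔ b) = p n a ⊔ p n b)
    (hred : ∀ n, ∀ y : X n, ∃ x : ∀ m, X m, x ∈ ProjLim p ∧ x n = y)
    (X₀ : Submodule ℝ ↥(ProjLim p))
    (q1 : X 0 → ℝ) (hq1mono : Monotone q1)
    (hq1add : ∀ a b : X 0, q1 a + q1 b ≤ q1 (a + b))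
    (hq1hom : ∀ t : ℝ, 0 < t → ∀ a : X 0, q1 (t • a) = t * q1 a)
    (H : Set ↥(ProjLim p))
    (hHadd : ∀ h ∈ H, ∀ h' ∈ H, h + h' ∈ H)
    (hHsmul : ∀ t : ℝ, 0 < t → ∀ h ∈ H, t • h ∈ H)
    -- (i): every projection of H contains a negative element
    (hneg : ∀ n : ℕ, ∃ h ∈ (fun x : ↥(ProjLim p) => (x : ∀ m, X m) n) '' H,
      h ≤ 0)
    -- (ii): every projection of H minorizes the corresponding projection of X₀
    (hmin : ∀ n : ℕ,
      ∀ y ∈ (fun x : ↥(ProjLim p) => (x : ∀ m, X m) n) '' (X₀ : Set ↥(ProjLim p)),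
      ∃ h ∈ (fun x : ↥(ProjLim p) => (x : ∀ m, X m) n) '' H, h ≤ y)
    -- (iii): suprema of bounded-above subsets of H exist in X and lie in H
    (hsup : ∀ S : Set ↥(ProjLim p), S ⊆ H → S.Nonempty →
      (∃ u : ↥(ProjLim p), ∀ s ∈ S, s ≤ u) → ∃ v ∈ H, IsLUB S v)
    -- (iv): infima of decreasing bounded-below sequences in H exist and lie in H
    (hinf : ∀ h : ℕ → ↥(ProjLim p), (∀ k, h k ∈ H) →
      (∀ k, h (k + 1) ≤ h k) → (∃ b : ↥(ProjLim p), ∀ k, b ≤ h k) →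
      ∃ v ∈ H, IsGLB (Set.range h) v)
    -- (v)
    (hqv : ∀ h : ℕ → ↥(ProjLim p), (∀ k, h k ∈ H) →
      (∀ k, h (k + 1) ≤ h k) →
      BddBelow (Set.range fun k => q1 ((h k : ∀ m, X m) 0)) →
      (∃ b : ↥(ProjLim p), ∀ k, b ≤ h k) ∧
      (∀ w : ↥(ProjLim p), IsGLB (Set.range h) w →
        (⨅ k, q1 ((h k : ∀ m, X m) 0)) ≤ q1 ((w : ∀ m, X m) 0))) :
    (∀ x y : ↥(ProjLim p),
      spf H (fun x' : ↥(ProjLim p) => q1 ((x' : ∀ m, X m) 0)) x +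
        spf H (fun x' : ↥(ProjLim p) => q1 ((x' : ∀ m, X m) 0)) y ≤
        spf H (fun x' : ↥(ProjLim p) => q1 ((x' : ∀ m, X m) 0)) (x + y)) ∧
    (∀ t : ℝ, 0 < t → ∀ x : ↥(ProjLim p),
      spf H (fun x' : ↥(ProjLim p) => q1 ((x' : ∀ m, X m) 0)) (t • x) =
        (t : EReal) * spf H (fun x' : ↥(ProjLim p) => q1 ((x' : ∀ m, X m) 0)) x) ∧
    (∀ x : ↥(ProjLim p), ∀ hx : x ∈ X₀,
      spf H (fun x' : ↥(ProjLim p) => q1 ((x' : ∀ m, X m) 0)) x =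
        sInf {r : EReal | ∃ l : X₀ →ₗ[ℝ] ℝ,
          (∀ h ∈ H, ∀ x' : ↥X₀, h ≤ (x' : ↥(ProjLim p)) →
            q1 ((h : ∀ m, X m) 0) ≤ l x') ∧
          r = (l ⟨x, hx⟩ : EReal)}) := by
  have hordered : ∀ n, IsOrderedAddMonoid (X n) := fun n =>
    { add_le_add_left := fun a b hab c => by
        rw [add_comm a, add_comm b]
        exact CovariantClass.elim c hab }
  have hsmul_le : ∀ t : ℝ, 0 < t → ∀ a b : ProjLim p, a ≤ b → t • a ≤ t • b :=
    fun t ht _ _ hab m => smul_le_smul_of_nonneg_left (hab m) ht.le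
  refine ⟨spf_add_le (fun _ _ _ _ hab hcd m => add_le_add (hab m) (hcd m)) hHadd
      fun _ _ => hq1add _ _,
    fun t ht => spf_smul (q := fun x : ProjLim p => q1 ((x : ∀ m, X m) 0)) hsmul_le hHsmul
      (fun t ht _ => hq1hom t ht _) ht,
    fun x hx => le_antisymm ?_ ?_⟩
  · refine le_sInf ?_
    rintro _ ⟨l, hl, rfl⟩
    refine sSup_le ?_
    rintro _ ⟨h, hh, hhx, rfl⟩
    exact EReal.coe_le_coe_iff.2 (hl h hh ⟨x, hx⟩ hhx)
  · refine EReal.ge_of_forall_gt_iff_ge.1 fun c hcx => ?_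
    obtain ⟨h, hh, hhx, hch⟩ := ProjLim.exists_mem_le_of_forall_level hreg hq1mono hsup hinf hqv
      x c fun n => by
        let A : X₀ → Set ℝ := fun y => {r | ∃ h ∈ H,
          (h : ∀ m, X m) n ≤ ((y : ProjLim p) : ∀ m, X m) n ∧ r = q1 ((h : ∀ m, X m) 0)}
        have hne : ∀ y, (A y).Nonempty := fun y => by
          obtain ⟨_, ⟨h, hh, rfl⟩, hy⟩ := hmin n _ ⟨y, y.2, rfl⟩
          exact ⟨_, h, hh, hy, rfl⟩
        obtain ⟨l, hl, hlx⟩ := exists_linearMap_ge_eq_sSup A hne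
          (fun y => ⟨q1 (((y : ProjLim p) : ∀ m, X m) 0), by
            rintro _ ⟨h, -, hy, rfl⟩
            exact hq1mono (ProjLim.apply_le_of_le hreg n.zero_le hy)⟩)
          (by
            rintro y z _ ⟨h, hh, hy, rfl⟩ _ ⟨h', hh', hz, rfl⟩
            exact ⟨_, ⟨h + h', hHadd h hh h' hh', add_le_add hy hz, rfl⟩, hq1add _ _⟩)
          (by
            rintro t ht y _ ⟨h, hh, hy, rfl⟩
            exact ⟨t • h, hHsmul t ht h hh, smul_le_smul_of_nonneg_left hy ht.le,
              (hq1hom t ht _).symm⟩)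
          ⟨x, hx⟩
        have hcl : (c : EReal) < l ⟨x, hx⟩ := hcx.trans_le
          (sInf_le ⟨l, fun h hh y hy => hl y _ ⟨h, hh, hy n, rfl⟩, rfl⟩)
        rw [hlx, EReal.coe_lt_coe_iff] at hcl
        obtain ⟨_, ⟨h, hh, hhx, rfl⟩, hch⟩ := exists_lt_of_lt_csSup (hne _) hcl
        exact ⟨h, hh, hhx, hch.le⟩
    exact (EReal.coe_le_coe_iff.2 hch).trans
      (le_spf (q := fun x : ProjLim p => q1 ((x : ∀ m, X m) 0)) hh hhx)
end

section
/- Let X = projlim X_n p_n be a reduced regular projective limit of real vector lattices, X_0 ⊆ X a linear subspace, q₁ : X_1 → ℝ increasing and superlinear, q := q₁ ∘ pr_1 : X → ℝ, H ⊆ X a convex cone, and H_n := pr_n H. Assume: (i) for every n there is h ∈ H_n with h ≤ 0; (ii) for every n and every y ∈ pr_n X_0 there is h ∈ H_n with h ≤ y; (iii–iv) for every sequence (h^(k)) in H that is bounded above and below in X, the upper limit limsup_k h^(k) := inf_n sup_{k≥n} h^(k) exists in X and belongs to H; (v) whenever (h^(k)) ⊆ H is a decreasing sequence with inf_k q(h^(k))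 > -∞, the sequence is bounded below in X and q(inf_k h^(k)) ≥ inf_k q(h^(k)). Then for every x ∈ X_0: spf_{H,q}(x) = inf{ l(x) : l : X_0 → ℝ linear, q(h) ≤ l(x') for all h ∈ H, x' ∈ X_0 with h ≤ x' } (infimum in ℝ ∪ {±∞}, inf ∅ = +∞). Moreover, if H contains an element h₀ ≤ 0 of X, then the infimum can be restricted to positive linear functionals l (l(x) ≥ 0 for x ∈ X_0 with x ≥ 0). -/
/-
A sequence `(X n)` of real vector lattices with positive linear maps
`p n : X (n+1) →ₗ[ℝ] X n` is given.  The projective limit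
`projlim Xₙ pₙ` is realized as the submodule of the product `∀ n, X n`
consisting of all `x` with `x n = p n (x (n+1))` for all `n`, ordered
componentwise (the subtype order induced from the product order).
-/

variable {X : ℕ → Type*} [∀ n, Lattice (X n)] [∀ n, AddCommGroup (X n)]
  [∀ n, Module ℝ (X n)]
  [∀ n, CovariantClass (X n) (X n) (· + ·) (· ≤ ·)]
  [∀ n, PosSMulMono ℝ (X n)]

/-- Hahn–Banach for a superlinear functional given as a pointwise supremum. -/
theorem exists_linearMap_upperBound_isLUB {E : Type*} [AddCommGroup E] [Module ℝ E]
    (A : E → Set ℝ) (hne : ∀ x, (A x).Nonempty) (hbdd : ∀ x, BddAbove (A x))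
    (hadd : ∀ x y, ∀ r ∈ A x, ∀ s ∈ A y, ∃ t ∈ A (x + y), r + s ≤ t)
    (hsmul : ∀ c : ℝ, 0 < c → ∀ x, ∀ r ∈ A x, c * r ∈ A (c • x)) (x : E) :
    ∃ l : E →ₗ[ℝ] ℝ, (∀ y, ∀ r ∈ A y, r ≤ l y) ∧ IsLUB (A x) (l x) := by
  set S : E → ℝ := fun y => sSup (A y) with hS
  have S_smul_le : ∀ c : ℝ, 0 < c → ∀ y, c * S y ≤ S (c • y) := by
    intro c hc y
    rw [← le_div_iff₀' hc]
    refine csSup_le (hne y) fun r hr => ?_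
    rw [le_div_iff₀' hc]
    exact le_csSup (hbdd _) (hsmul c hc y r hr)
  have S_smul : ∀ c : ℝ, 0 < c → ∀ y, S (c • y) = c * S y := by
    intro c hc y
    refine le_antisymm ?_ (S_smul_le c hc y)
    have h := S_smul_le c⁻¹ (inv_pos.2 hc) (c • y)
    rwa [inv_smul_smul₀ hc.ne', inv_mul_le_iff₀ hc] at h
  have S_add : ∀ y z, S y + S z ≤ S (y + z) := by
    intro y z
    rw [← le_sub_iff_add_le]
    refine csSup_le (hne y) fun r hr => ?_
    rw [le_sub_iff_add_le', ← le_sub_iff_add_le]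
    refine csSup_le (hne z) fun s hs => ?_
    obtain ⟨t, ht, hrt⟩ := hadd y z r hr s hs
    have := le_csSup (hbdd _) ht
    simp only [hS]
    linarith
  have S_zero : S 0 = 0 := by
    have h := S_smul 2 two_pos 0
    rw [smul_zero] at h
    linarith
  have S_mul_ge : ∀ c : ℝ, S (c • x) ≤ c * S x := by
    intro c
    rcases lt_trichotomy c 0 with hc | rfl | hc
    · have h := S_add (c • x) ((-c) • x)
      rw [← add_smul, add_neg_cancel, zero_smul, S_zero, S_smul (-c) (by linarith)] at h
      linarith
    · simp [S_zero]
    · exact (S_smul c hc x).le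
  have hwd : ∀ c : ℝ, c • x = 0 → c • (-S x) = 0 := by
    intro c hc
    rcases smul_eq_zero.1 hc with rfl | rfl
    · simp
    · simp [S_zero]
  obtain ⟨g, hg, hgS⟩ := exists_extension_of_le_sublinear
    (LinearPMap.mkSpanSingleton' x (-S x) hwd) (fun y => -S y)
    (fun c hc y => by simp [S_smul c hc y])
    (fun y z => by have := S_add y z; linarith)
    (by
      rintro ⟨y, hy⟩
      obtain ⟨c, rfl⟩ := Submodule.mem_span_singleton.1 hy
      rw [LinearPMap.mkSpanSingleton'_apply]
      have := S_mul_ge c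
      simp only [RingHom.id_apply, smul_eq_mul]
      linarith)
  refine ⟨-g, fun y r hr => ?_, ?_⟩
  · have h₁ := hgS y
    have h₂ := le_csSup (hbdd y) hr
    simp only [LinearMap.neg_apply]
    linarith
  · have h : g x = -S x := (hg ⟨x, Submodule.mem_span_singleton_self x⟩).trans
      (LinearPMap.mkSpanSingleton'_apply_self _ _ _ _)
    rw [LinearMap.neg_apply, h, neg_neg]
    exact isLUB_csSup (hne x) (hbdd x)

section UpperLimits

variable {E : Type*} [Lattice E] {H : Set E}

/-- Every order bounded sequence in `H` has an upper limit, and it belongs to `H`. -/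
def HasUpperLimits (H : Set E) : Prop :=
  ∀ h : ℕ → E, (∀ k, h k ∈ H) → (∃ u, ∀ k, h k ≤ u) → (∃ b, ∀ k, b ≤ h k) →
    ∃ s : ℕ → E, (∀ n : ℕ, IsLUB {y | ∃ k, n ≤ k ∧ y = h k} (s n)) ∧
      ∃ v ∈ H, IsGLB (Set.range s) v

theorem HasUpperLimits.supClosed (hH : HasUpperLimits H) : SupClosed H := by
  intro a ha b hb
  obtain ⟨s, hs, v, hv, hsv⟩ := hH (fun k => if Even k then a else b)
    (fun k => by split_ifs <;> assumption)
    ⟨a ⊔ b, fun k => by split_ifs <;> simp⟩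
    ⟨a ⊓ b, fun k => by split_ifs <;> simp⟩
  have hs' : ∀ n, s n = a ⊔ b := by
    intro n
    refine (hs n).unique ⟨?_, ?_⟩
    · rintro y ⟨k, -, rfl⟩
      split_ifs <;> simp
    · intro w hw
      refine sup_le (hw ⟨2 * n, by omega, by simp⟩) (hw ⟨2 * n + 1, by omega, by simp⟩)
  obtain rfl : s = fun _ => a ⊔ b := funext hs'
  rw [Set.range_const] at hsv
  rwa [← hsv.unique isGLB_singleton]

theorem HasUpperLimits.exists_isLUB (hH : HasUpperLimits H) {h : ℕ → E} (hh : ∀ k, h k ∈ H)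
    (hb : BddAbove (Set.range h)) : ∃ s ∈ H, IsLUB (Set.range h) s := by
  obtain ⟨u, hu⟩ := hb
  have hu' : ∀ k, partialSups h k ≤ u := fun k =>
    partialSups_le h k u fun i _ => hu ⟨i, rfl⟩
  have hmem : ∀ k, partialSups h k ∈ H := by
    intro k
    induction k with
    | zero => simpa using hh 0
    | succ k ih => rw [partialSups_add_one]; exact hH.supClosed ih (hh _)
  obtain ⟨s, hs, v, hv, hsv⟩ := hH (partialSups h) hmem ⟨u, hu'⟩
    ⟨h 0, fun k => le_partialSups_of_le h (Nat.zero_le k)⟩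
  have hs' : ∀ n, IsLUB (Set.range h) (s n) := by
    intro n
    constructor
    · rintro _ ⟨k, rfl⟩
      exact (le_partialSups_of_le h (le_max_right n k)).trans ((hs n).1 ⟨_, le_max_left n k, rfl⟩)
    · intro w hw
      refine (hs n).2 ?_
      rintro _ ⟨k, -, rfl⟩
      exact partialSups_le h k w fun i _ => hw ⟨i, rfl⟩
  have hs0 : s = fun _ => s 0 := funext fun n => (hs' n).unique (hs' 0)
  rw [hs0, Set.range_const] at hsv
  exact ⟨v, hv, hsv.unique isGLB_singleton ▸ hs' 0⟩

theorem HasUpperLimits.exists_isGLB_of_antitone (hH : HasUpperLimits H) {s : ℕ → E}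
    (hs : ∀ k, s k ∈ H) (hanti : Antitone s) (hb : ∃ b, ∀ k, b ≤ s k) :
    ∃ v ∈ H, IsGLB (Set.range s) v := by
  obtain ⟨s', hs', v, hv, hsv⟩ := hH s hs ⟨s 0, fun k => hanti (Nat.zero_le k)⟩ hb
  obtain rfl : s' = s := by
    funext n
    refine (hs' n).unique ⟨?_, fun w hw => hw ⟨n, le_rfl, rfl⟩⟩
    rintro _ ⟨k, hk, rfl⟩
    exact hanti hk
  exact ⟨v, hv, hsv⟩

theorem HasUpperLimits.exists_upperLimit_le_map (hH : HasUpperLimits H) {q : E → ℝ}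
    (hq : Monotone q)
    (hqv : ∀ h : ℕ → E, (∀ k, h k ∈ H) → (∀ k, h (k + 1) ≤ h k) →
      BddBelow (Set.range fun k => q (h k)) →
      (∃ b, ∀ k, b ≤ h k) ∧ ∀ w, IsGLB (Set.range h) w → (⨅ k, q (h k)) ≤ q w)
    {h : ℕ → E} (hh : ∀ k, h k ∈ H) (hb : BddAbove (Set.range h)) {a : ℝ}
    (ha : ∀ k, a ≤ q (h k)) :
    ∃ s : ℕ → E, (∀ n, IsLUB (Set.range fun k => h (n + k)) (s n)) ∧
      ∃ v ∈ H, IsGLB (Set.range s) v ∧ a ≤ q v := by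
  choose s hsH hs using fun n => hH.exists_isLUB (h := fun k => h (n + k)) (fun k => hh _)
    (hb.mono (by rintro _ ⟨k, rfl⟩; exact ⟨_, rfl⟩))
  have hanti : Antitone s := by
    refine antitone_nat_of_succ_le fun n => (hs (n + 1)).2 ?_
    rintro _ ⟨k, rfl⟩
    exact (hs n).1 ⟨1 + k, by simp [add_assoc]⟩
  have has : ∀ n, a ≤ q (s n) := fun n => (ha n).trans (hq ((hs n).1 ⟨0, rfl⟩))
  obtain ⟨hbs, hle⟩ := hqv s hsH (fun k => hanti k.le_succ)
    ⟨a, by rintro _ ⟨k, rfl⟩; exact has k⟩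
  obtain ⟨v, hv, hsv⟩ := hH.exists_isGLB_of_antitone hsH hanti hbs
  exact ⟨s, hs, v, hv, hsv, (le_ciInf has).trans (hle v hsv)⟩

end UpperLimits

/-- A regular projective limit of vector lattices is a lattice for the componentwise order. -/
abbrev ProjLim.lattice (p : ∀ n, X (n + 1) →ₗ[ℝ] X n)
    (hreg : ∀ n, ∀ a b : X (n + 1), p n (a ⊔ b) = p n a ⊔ p n b) : Lattice ↥(ProjLim p) :=
  { (inferInstance : PartialOrder ↥(ProjLim p)) with
    sup := fun a b => ⟨a.1 ⊔ b.1, fun n => by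
      simp only [Pi.sup_apply]
      rw [hreg, ← a.2 n, ← b.2 n]⟩
    inf := fun a b => ⟨a.1 ⊓ b.1, fun n => by
      have hinf : ∀ a b : X (n + 1), p n (a ⊓ b) = p n a ⊓ p n b := fun a b => by
        rw [← add_left_inj (p n a ⊔ p n b), inf_add_sup, ← hreg, ← map_add, inf_add_sup,
          map_add]
      simp only [Pi.inf_apply]
      rw [hinf, ← a.2 n, ← b.2 n]⟩
    le_sup_left := fun a b => (le_sup_left : a.1 ≤ a.1 ⊔ b.1)
    le_sup_right := fun a b => (le_sup_right : b.1 ≤ a.1 ⊔ b.1)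
    sup_le := fun a b c h₁ h₂ => (sup_le h₁ h₂ : a.1 ⊔ b.1 ≤ c.1)
    inf_le_left := fun a b => (inf_le_left : a.1 ⊓ b.1 ≤ a.1)
    inf_le_right := fun a b => (inf_le_right : a.1 ⊓ b.1 ≤ b.1)
    le_inf := fun a b c h₁ h₂ => (le_inf h₁ h₂ : a.1 ≤ b.1 ⊓ c.1) }

set_option linter.unusedSectionVars false in
theorem ProjLim.apply_le_of_le_s16 {p : ∀ n, X (n + 1) →ₗ[ℝ] X n}
    (hpos : ∀ n, ∀ a : X (n + 1), 0 ≤ a → 0 ≤ p n a) {x y : ↥(ProjLim p)} {m n : ℕ}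
    (hmn : m ≤ n) (hxy : x.1 n ≤ y.1 n) : x.1 m ≤ y.1 m := by
  induction n, hmn using Nat.le_induction with
  | base => exact hxy
  | succ n _ ih =>
    refine ih ?_
    rw [x.2 n, y.2 n, ← sub_nonneg, ← map_sub]
    exact hpos n _ (sub_nonneg.2 hxy)

set_option linter.unusedSectionVars false in
/-- A sequence in a regular projective limit whose components are eventually bounded by those of
`x` is bounded above, by an element whose first components agree with those of `x`. -/
theorem ProjLim.exists_upperBound_s16 {p : ∀ n, X (n + 1) →ₗ[ℝ] X n}
    (hreg : ∀ n, ∀ a b : X (n + 1), p n (a ⊔ b) = p n a ⊔ p n b)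
    {h : ℕ → ↥(ProjLim p)} {x : ↥(ProjLim p)} {n : ℕ}
    (hle : ∀ k m, m ≤ n + k → (h k).1 m ≤ x.1 m) :
    ∃ u : ↥(ProjLim p), (∀ k, h k ≤ u) ∧ ∀ m ≤ n, u.1 m ≤ x.1 m := by
  let _ := ProjLim.lattice p hreg
  let w : ℕ → ↥(ProjLim p) := fun j => Nat.rec x (fun k y => y ⊔ h k) j
  have w_succ : ∀ j m, (w (j + 1)).1 m = (w j).1 m ⊔ (h j).1 m := fun j m => rfl
  have w_mono : Monotone w := monotone_nat_of_le_succ fun j => (le_sup_left : w j ≤ w j ⊔ h j)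
  have x_le : ∀ j m, x.1 m ≤ (w j).1 m := fun j => w_mono (Nat.zero_le j)
  have w_const : ∀ m j, m ≤ j → (w j).1 m = (w m).1 m := by
    intro m j hj
    induction j, hj using Nat.le_induction with
    | base => rfl
    | succ j hj ih =>
      rw [w_succ, ← ih]
      exact sup_eq_left.2 ((hle j m (by omega)).trans (x_le j m))
  refine ⟨⟨fun m => (w m).1 m, fun m => ?_⟩, fun k m => ?_, fun m hm => ?_⟩
  · rw [← (w (m + 1)).2 m, w_const m (m + 1) m.le_succ]
  · calc (h k).1 m ≤ (w (k + 1)).1 m := by rw [w_succ]; exact le_sup_right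
      _ ≤ (w (max (k + 1) m)).1 m := w_mono (le_max_left (k + 1) m) m
      _ = (w m).1 m := w_const m _ (le_max_right _ _)
  · have : ∀ j, (w j).1 m ≤ x.1 m := by
      intro j
      induction j with
      | zero => exact le_rfl
      | succ j ih => rw [w_succ]; exact sup_le ih (hle j m (by omega))
    exact this m

/-
STATEMENT 16.  (Corollary to the representation theorem, `𝕂 = ℝ`.)
With hypotheses (i), (ii), (iii–iv) (existence of upper limits of
bounded sequences in `H` within `X`, belonging to `H`) and (v), the
supremal function of the increasing superlinear `q = q₁ ∘ pr₁` relative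
to the convex cone `H` is represented on the linear subspace `X₀` as
the infimum of its linear sweepings-out; if `H` contains an element
`h₀ ≤ 0`, the infimum may be restricted to positive linear functionals.
-/
theorem spf_representation_by_positive_linear_sweepings
    (p : ∀ n, X (n + 1) →ₗ[ℝ] X n)
    (hpos : ∀ n, ∀ a : X (n + 1), 0 ≤ a → 0 ≤ p n a)
    (hreg : ∀ n, ∀ a b : X (n + 1), p n (a ⊔ b) = p n a ⊔ p n b)
    (hred : ∀ n, ∀ y : X n, ∃ x : ∀ m, X m, x ∈ ProjLim p ∧ x n = y)
    (X₀ : Submodule ℝ ↥(ProjLim p))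
    (q1 : X 0 → ℝ) (hq1mono : Monotone q1)
    (hq1add : ∀ a b : X 0, q1 a + q1 b ≤ q1 (a + b))
    (hq1hom : ∀ t : ℝ, 0 < t → ∀ a : X 0, q1 (t • a) = t * q1 a)
    (H : Set ↥(ProjLim p))
    (hHadd : ∀ h ∈ H, ∀ h' ∈ H, h + h' ∈ H)
    (hHsmul : ∀ t : ℝ, 0 < t → ∀ h ∈ H, t • h ∈ H)
    -- (i)
    (hneg : ∀ n : ℕ, ∃ h ∈ (fun x : ↥(ProjLim p) => (x : ∀ m, X m) n) '' H,
      h ≤ 0)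
    -- (ii)
    (hmin : ∀ n : ℕ,
      ∀ y ∈ (fun x : ↥(ProjLim p) => (x : ∀ m, X m) n) '' (X₀ : Set ↥(ProjLim p)),
      ∃ h ∈ (fun x : ↥(ProjLim p) => (x : ∀ m, X m) n) '' H, h ≤ y)
    -- (iii–iv): upper limits of bounded sequences in H exist in X and lie in H
    (hlimsup : ∀ h : ℕ → ↥(ProjLim p), (∀ k, h k ∈ H) →
      (∃ u : ↥(ProjLim p), ∀ k, h k ≤ u) →
      (∃ b : ↥(ProjLim p), ∀ k, b ≤ h k) →
      ∃ s : ℕ → ↥(ProjLim p),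
        (∀ n : ℕ, IsLUB {y : ↥(ProjLim p) | ∃ k, n ≤ k ∧ y = h k} (s n)) ∧
        ∃ v ∈ H, IsGLB (Set.range s) v)
    -- (v)
    (hqv : ∀ h : ℕ → ↥(ProjLim p), (∀ k, h k ∈ H) →
      (∀ k, h (k + 1) ≤ h k) →
      BddBelow (Set.range fun k => q1 ((h k : ∀ m, X m) 0)) →
      (∃ b : ↥(ProjLim p), ∀ k, b ≤ h k) ∧
      (∀ w : ↥(ProjLim p), IsGLB (Set.range h) w →
        (⨅ k, q1 ((h k : ∀ m, X m) 0)) ≤ q1 ((w : ∀ m, X m) 0))) :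
    (∀ x : ↥(ProjLim p), ∀ hx : x ∈ X₀,
      spf H (fun x' : ↥(ProjLim p) => q1 ((x' : ∀ m, X m) 0)) x =
        sInf {r : EReal | ∃ l : X₀ →ₗ[ℝ] ℝ,
          (∀ h ∈ H, ∀ x' : ↥X₀, h ≤ (x' : ↥(ProjLim p)) →
            q1 ((h : ∀ m, X m) 0) ≤ l x') ∧
          r = (l ⟨x, hx⟩ : EReal)}) ∧
    ((∃ h₀ ∈ H, h₀ ≤ 0) →
      ∀ x : ↥(ProjLim p), ∀ hx : x ∈ X₀,
        spf H (fun x' : ↥(ProjLim p) => q1 ((x' : ∀ m, X m) 0)) x =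
          sInf {r : EReal | ∃ l : X₀ →ₗ[ℝ] ℝ,
            (∀ x' : ↥X₀, 0 ≤ (x' : ↥(ProjLim p)) → 0 ≤ l x') ∧
            (∀ h ∈ H, ∀ x' : ↥X₀, h ≤ (x' : ↥(ProjLim p)) →
              q1 ((h : ∀ m, X m) 0) ≤ l x') ∧
            r = (l ⟨x, hx⟩ : EReal)}) := by
  have hle_map : Monotone fun x : ↥(ProjLim p) => q1 (x.1 0) := fun x y hxy => hq1mono (hxy 0)
  have hq1zero : q1 0 = 0 := by
    have h := hq1hom 2 two_pos 0
    rw [smul_zero] at h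
    linarith
  have key : ∀ x : ↥(ProjLim p), ∀ hx : x ∈ X₀,
      spf H (fun x' : ↥(ProjLim p) => q1 ((x' : ∀ m, X m) 0)) x =
        sInf {r : EReal | ∃ l : X₀ →ₗ[ℝ] ℝ,
          (∀ h ∈ H, ∀ x' : ↥X₀, h ≤ (x' : ↥(ProjLim p)) →
            q1 ((h : ∀ m, X m) 0) ≤ l x') ∧
          r = (l ⟨x, hx⟩ : EReal)} := by
    intro x hx
    apply le_antisymm
    · refine le_sInf ?_
      rintro _ ⟨l, hl, rfl⟩
      refine sSup_le ?_
      rintro _ ⟨h, hh, hhx, rfl⟩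
      exact EReal.coe_le_coe_iff.2 (hl h hh ⟨x, hx⟩ hhx)
    · refine EReal.ge_of_forall_gt_iff_ge.1 fun a ha => ?_
      have hex : ∀ n : ℕ, ∃ h ∈ H, h.1 n ≤ x.1 n ∧ a ≤ q1 (h.1 0) := by
        intro n
        obtain ⟨l, hl, hlx⟩ := exists_linearMap_upperBound_isLUB
          (fun y : X₀ => {r : ℝ | ∃ h ∈ H, h.1 n ≤ y.1.1 n ∧ q1 (h.1 0) = r})
          (fun y => by
            obtain ⟨_, ⟨h, hh, rfl⟩, hhy⟩ := hmin n (y.1.1 n) ⟨y.1, y.2, rfl⟩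
            exact ⟨_, h, hh, hhy, rfl⟩)
          (fun y => ⟨q1 (y.1.1 0), by
            rintro _ ⟨h, hh, hhy, rfl⟩
            exact hq1mono (ProjLim.apply_le_of_le_s16 hpos (Nat.zero_le n) hhy)⟩)
          (by
            rintro y z _ ⟨h, hh, hhy, rfl⟩ _ ⟨h', hh', hhz, rfl⟩
            exact ⟨_, ⟨h + h', hHadd h hh h' hh', add_le_add hhy hhz, rfl⟩, hq1add _ _⟩)
          (by
            rintro c hc y _ ⟨h, hh, hhy, rfl⟩
            exact ⟨c • h, hHsmul c hc h hh, smul_le_smul_of_nonneg_left hhy hc.le,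
              hq1hom c hc _⟩)
          ⟨x, hx⟩
        have hal : a < l ⟨x, hx⟩ := by
          refine EReal.coe_lt_coe_iff.1 (ha.trans_le (sInf_le ⟨l, ?_, rfl⟩))
          exact fun h hh x' hhx' => hl x' _ ⟨h, hh, hhx' n, rfl⟩
        obtain ⟨_, ⟨h', hh', hhx', rfl⟩, hlt⟩ := (lt_isLUB_iff hlx).1 hal
        exact ⟨h', hh', hhx', hlt.le⟩
      choose h hh hhx hqh using hex
      have hle : ∀ n k m, m ≤ n + k → (h (n + k)).1 m ≤ x.1 m := fun n k m hm =>
        ProjLim.apply_le_of_le_s16 hpos hm (hhx _)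
      let _ := ProjLim.lattice p hreg
      have hH : HasUpperLimits H := hlimsup
      obtain ⟨u, hu, -⟩ := ProjLim.exists_upperBound_s16 hreg
        (fun k m hm => by simpa using hle 0 k m hm : ∀ k m, m ≤ 0 + k → (h k).1 m ≤ x.1 m)
      obtain ⟨s, hs, v, hv, hsv, hav⟩ := hH.exists_upperLimit_le_map hle_map hqv hh
        ⟨u, by rintro _ ⟨k, rfl⟩; exact hu k⟩ hqh
      have hvx : v ≤ x := by
        intro n
        obtain ⟨u, hu, hux⟩ := ProjLim.exists_upperBound_s16 hreg (hle n)
        have hsu : s n ≤ u := (hs n).2 (by rintro _ ⟨k, rfl⟩; exact hu k)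
        have hvs : v ≤ s n := hsv.1 ⟨n, rfl⟩
        exact (hvs n).trans ((hsu n).trans (hux n le_rfl))
      exact (EReal.coe_le_coe_iff.2 hav).trans (le_sSup ⟨v, hv, hvx, rfl⟩)
  refine ⟨key, ?_⟩
  rintro ⟨h₀, hh₀, hh₀le⟩ x hx
  rw [key x hx]
  congr 1
  ext r
  refine exists_congr fun l => ⟨fun ⟨hl, hr⟩ => ⟨fun x' hx' => ?_, hl, hr⟩,
    fun ⟨_, hl, hr⟩ => ⟨hl, hr⟩⟩
  by_contra! hlt
  have hq : q1 (h₀.1 0) ≤ 0 := hq1zero ▸ hle_map hh₀le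
  have hc : 0 ≤ (q1 (h₀.1 0) - 1) / l x' := div_nonneg_of_nonpos (by linarith) hlt.le
  have hcx : (0 : ↥(ProjLim p)) ≤ ((q1 (h₀.1 0) - 1) / l x') • x'.1 := fun n =>
    smul_nonneg hc (hx' n)
  have h := hl h₀ hh₀ (((q1 (h₀.1 0) - 1) / l x') • x') (hh₀le.trans hcx)
  rw [map_smul, smul_eq_mul, div_mul_cancel₀ _ hlt.ne] at h
  linarith
end

section
/- Let X be a lattice and H ⊆ X a subset. Then the following two conditions are equivalent: (A) for every sequence (h^(k))_{k∈ℕ} in H that is bounded above and below in X, the upper limit limsup_k h^(k) := inf_n sup_{k≥n} h^(k) exists in X (all the inner suprema and the outer infimum exist) and belongs to H; (B) every sequence in H that is bounded above in X has a supremum in X belonging to H, and every decreasing sequence in H that is bounded below in X has an infimum in X belonging to H. -/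
/-
STATEMENT 18.  For a lattice `X` and a subset `H ⊆ X`, the following are
equivalent:
(A) for every sequence in `H` bounded above and below in `X`, the upper
limit `limsup_k h k = inf_n sup_{k ≥ n} h k` exists in `X` (all inner
suprema and the outer infimum exist) and belongs to `H`;
(B) every sequence in `H` bounded above in `X` has a supremum in `X`
belonging to `H`, and every decreasing sequence in `H` bounded below in
`X` has an infimum in `X` belonging to `H`.
-/
theorem limsup_closed_iff_sup_and_inf_closed
    {X : Type*} [Lattice X] (H : Set X) :
    (∀ h : ℕ → X, (∀ k, h k ∈ H) →
      (∃ u : X, ∀ k, h k ≤ u) → (∃ b : X, ∀ k, b ≤ h k) →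
      ∃ s : ℕ → X,
        (∀ n : ℕ, IsLUB {y : X | ∃ k, n ≤ k ∧ y = h k} (s n)) ∧
        ∃ v ∈ H, IsGLB (Set.range s) v) ↔
    ((∀ h : ℕ → X, (∀ k, h k ∈ H) → (∃ u : X, ∀ k, h k ≤ u) →
        ∃ v ∈ H, IsLUB (Set.range h) v) ∧
     (∀ h : ℕ → X, (∀ k, h k ∈ H) → (∀ k, h (k + 1) ≤ h k) →
        (∃ b : X, ∀ k, b ≤ h k) →
        ∃ v ∈ H, IsGLB (Set.range h) v)) := by
  constructor
  · intro hA
    have hsup : ∀ a ∈ H, ∀ c ∈ H, a ⊔ c ∈ H := by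
      intro a ha c hc
      obtain ⟨s, hs, v, hv, hglb⟩ := hA (fun k => if Even k then a else c)
        (fun k => by split_ifs <;> assumption)
        ⟨a ⊔ c, fun k => by split_ifs <;> simp⟩
        ⟨a ⊓ c, fun k => by split_ifs <;> simp⟩
      have hs_eq : ∀ n, s n = a ⊔ c := by
        intro n
        apply le_antisymm
        · apply (hs n).2
          rintro y ⟨k, -, rfl⟩
          split_ifs <;> simp
        · apply sup_le
          · exact (hs n).1 ⟨2 * n, by omega, by simp⟩
          · exact (hs n).1 ⟨2 * n + 1, by omega, by simp⟩
      have hv_eq : v = a ⊔ c := by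
        apply le_antisymm
        · exact (hglb.1 ⟨0, rfl⟩).trans_eq (hs_eq 0)
        · apply hglb.2
          rintro _ ⟨n, rfl⟩
          exact (hs_eq n).ge
      exact hv_eq ▸ hv
    refine ⟨fun h hH ⟨u, hu⟩ => ?_, fun h hH hdec ⟨b, hb⟩ => ?_⟩
    · have hpH : ∀ n, partialSups h n ∈ H := by
        intro n
        induction n with
        | zero => simpa using hH 0
        | succ n ih =>
          rw [partialSups_add_one]
          exact hsup _ ih _ (hH _)
      obtain ⟨s, hs, v, hv, hglb⟩ := hA (partialSups h) hpH
        ⟨u, fun n => partialSups_le h n u fun k _ => hu k⟩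
        ⟨h 0, fun n => le_partialSups_of_le h n.zero_le⟩
      refine ⟨v, hv, ?_, ?_⟩
      · rintro _ ⟨k, rfl⟩
        apply hglb.2
        rintro _ ⟨n, rfl⟩
        exact (le_partialSups_of_le h (le_max_right n k)).trans
          ((hs n).1 ⟨max n k, le_max_left n k, rfl⟩)
      · intro w hw
        refine (hglb.1 ⟨0, rfl⟩).trans ((hs 0).2 ?_)
        rintro _ ⟨k, -, rfl⟩
        exact partialSups_le h k w fun j _ => hw ⟨j, rfl⟩
    · have hanti : Antitone h := antitone_nat_of_succ_le hdec
      obtain ⟨s, hs, v, hv, hglb⟩ := hA h hH ⟨h 0, fun k => hanti k.zero_le⟩ ⟨b, hb⟩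
      have hs_eq : s = h := by
        funext n
        apply le_antisymm
        · apply (hs n).2
          rintro _ ⟨k, hk, rfl⟩
          exact hanti hk
        · exact (hs n).1 ⟨n, le_rfl, rfl⟩
      exact ⟨v, hv, hs_eq ▸ hglb⟩
  · rintro ⟨hSup, hInf⟩ h hH ⟨u, hu⟩ ⟨b, hb⟩
    choose s hsH hs using fun n : ℕ =>
      hSup (fun k => h (n + k)) (fun k => hH _) ⟨u, fun k => hu _⟩
    refine ⟨s, fun n => ⟨?_, fun w hw => (hs n).2 ?_⟩, hInf s hsH (fun n => (hs (n + 1)).2 ?_)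
      ⟨b, fun n => (hb n).trans ((hs n).1 ⟨0, rfl⟩)⟩⟩
    · rintro _ ⟨k, hk, rfl⟩
      exact (hs n).1 ⟨k - n, by simp [Nat.add_sub_cancel' hk]⟩
    · rintro _ ⟨k, rfl⟩
      exact hw ⟨n + k, Nat.le_add_right n k, rfl⟩
    · rintro _ ⟨k, rfl⟩
      exact (hs n).1 ⟨1 + k, by simp [Nat.add_assoc]⟩
end
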